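/- There is a universal constant C > 0 with the following property. Let T > 0 and let σ₊, σ₋ : [0,T] × ℝ² → ℝ be a smooth solution of the unscreened right-handed system ∂ₜσ₊ − 𝕌(σ₋)·∇σ₊ = 0, ∂ₜσ₋ + 𝕌(σ₊)·∇σ₋ = 0 with σ±(t,·) compactly supported for each t, and initial data τ± = σ±(0,·), not both identically zero. Write ‖τ‖_{L^p} = max{‖τ₊‖_{L^p}, ‖τ₋‖_{L^p}} and similarly for ‖∇τ‖. Then for all t ∈ [0,T] and both signs, 2 + ( ‖τ‖_{L¹}^{1/2} / ‖τ‖_{L∞}^{3/2} ) ‖∇σ±(t,·)‖_{L∞} ≤ exp[ e^{C t ‖τ‖_{L∞}} · log( 2 + ‖∇τ‖_{L∞} ‖τ‖_{L¹}^{1/2} / ‖τ‖_{L∞}^{3/2} ) ]; in particular the gradient grows at most doubly exponentially in time, with a bound invariant under the scaling σ±(x,t) ↦ σ±(x/L, t). -/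

import Mathlib

open MeasureTheory ENNReal Set

noncomputable section

/-- The perpendicular rotation `(z₁, z₂)^⊥ = (−z₂, z₁)` in the plane. -/
def perp (z : EuclideanSpace ℝ (Fin 2)) : EuclideanSpace ℝ (Fin 2) :=
  (WithLp.equiv 2 (Fin 2 → ℝ)).symm ![-(z 1), z 0]

/-- The Biot–Savart velocity `𝕌(ω)(x) = (1/2π) ∫ ((x−y)^⊥/|x−y|²) ω(y) dy`. -/
def biotSavart (ω : EuclideanSpace ℝ (Fin 2) → ℝ) (x : EuclideanSpace ℝ (Fin 2)) :
    EuclideanSpace ℝ (Fin 2) :=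
  (1 / (2 * Real.pi)) • ∫ y, (ω y / ‖x - y‖ ^ 2) • perp (x - y)

/-- The `L¹(ℝ²)` norm as a real number. -/
def l1Norm (f : EuclideanSpace ℝ (Fin 2) → ℝ) : ℝ := (eLpNorm f 1 volume).toReal

/-- The `L∞(ℝ²)` norm as a real number. -/
def lInfNorm (f : EuclideanSpace ℝ (Fin 2) → ℝ) : ℝ := (eLpNorm f ⊤ volume).toReal

/-- The `L∞(ℝ²)` norm of the gradient as a real number. -/
def gradLInfNorm (f : EuclideanSpace ℝ (Fin 2) → ℝ) : ℝ :=
  (eLpNorm (fun x => ‖fderiv ℝ f x‖) ⊤ volume).toReal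

local notation "ℝ²" => EuclideanSpace ℝ (Fin 2)

lemma perp_apply_zero (z : ℝ²) : perp z 0 = -(z 1) := rfl

lemma perp_apply_one (z : ℝ²) : perp z 1 = z 0 := rfl

lemma perp_sub (a b : ℝ²) : perp (a - b) = perp a - perp b := by
  ext i; fin_cases i
  · change -((a - b) 1) = -(a 1) - -(b 1)
    simp; ring
  · rfl

lemma perp_smul (c : ℝ) (a : ℝ²) : perp (c • a) = c • perp a := by
  ext i; fin_cases i
  · change -((c • a) 1) = c * -(a 1)
    simp
  · rfl

lemma norm_perp (z : ℝ²) : ‖perp z‖ = ‖z‖ := by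
  rw [EuclideanSpace.norm_eq, EuclideanSpace.norm_eq]
  simp [Fin.sum_univ_two, perp_apply_zero, perp_apply_one, add_comm]

lemma continuous_perp : Continuous perp := by
  have h : LipschitzWith 1 perp := LipschitzWith.of_dist_le_mul fun a b => by
    rw [dist_eq_norm, dist_eq_norm, ← perp_sub, norm_perp]; simp
  exact h.continuous

lemma integral_radial (f : ℝ → ℝ) :
    ∫ z : ℝ², f ‖z‖ = 2 * Real.pi * ∫ y in Ioi (0 : ℝ), y * f y := by
  rw [integral_fun_norm_addHaar]
  have h : (volume : Measure ℝ²).real (Metric.ball 0 1) = Real.pi := by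
    rw [Measure.real, EuclideanSpace.volume_ball_fin_two]
    simp [Real.pi_pos.le]
  simp [h, mul_assoc]

lemma integrable_radial {f : ℝ → ℝ} (h : IntegrableOn (fun y => y * f y) (Ioi (0 : ℝ))) :
    Integrable fun z : ℝ² => f ‖z‖ := by
  rw [integrable_fun_norm_addHaar]
  simpa using h

lemma mul_indicator_inv_eqOn (r : ℝ) :
    EqOn (fun y : ℝ => y * (Iio r).indicator (fun s => s⁻¹) y) ((Iio r).indicator fun _ => 1)
      (Ioi 0) := by
  intro y hy
  by_cases h : y ∈ Iio r
  · simp [indicator_of_mem h, (mem_Ioi.1 hy).ne']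
  · simp [indicator_of_notMem h]

lemma integrable_indicator_inv_norm (r : ℝ) :
    Integrable fun z : ℝ² => (Iio r).indicator (fun s : ℝ => s⁻¹) ‖z‖ := by
  refine integrable_radial ?_
  rw [integrableOn_congr_fun (mul_indicator_inv_eqOn r) measurableSet_Ioi,
    IntegrableOn, integrable_indicator_iff measurableSet_Iio, IntegrableOn,
    Measure.restrict_restrict measurableSet_Iio, Iio_inter_Ioi]
  exact integrableOn_const (by simp)

lemma integral_indicator_inv_norm {r : ℝ} (hr : 0 ≤ r) :
    ∫ z : ℝ², (Iio r).indicator (fun s : ℝ => s⁻¹) ‖z‖ = 2 * Real.pi * r := by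
  rw [integral_radial, setIntegral_congr_fun measurableSet_Ioi (mul_indicator_inv_eqOn r),
    integral_indicator measurableSet_Iio, Measure.restrict_restrict measurableSet_Iio,
    Iio_inter_Ioi]
  simp [hr]

lemma mul_blob_diff_eqOn (r : ℝ) :
    EqOn (fun y : ℝ => y * (r ^ 2 / (y * (y ^ 2 + r ^ 2)))) (fun y => r ^ 2 / (y ^ 2 + r ^ 2))
      (Ioi 0) := by
  intro y hy
  have : y ≠ 0 := (mem_Ioi.1 hy).ne'
  have : y ^ 2 + r ^ 2 ≠ 0 := by positivity
  dsimp only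
  field_simp

lemma hasDerivAt_mul_arctan {r : ℝ} (hr : 0 < r) (y : ℝ) :
    HasDerivAt (fun y => r * Real.arctan (y / r)) (r ^ 2 / (y ^ 2 + r ^ 2)) y := by
  have h := (((hasDerivAt_id y).div_const r).arctan).const_mul r
  refine h.congr_deriv ?_
  have : y ^ 2 + r ^ 2 ≠ 0 := by positivity
  simp only [id]
  field_simp
  ring

lemma tendsto_mul_arctan {r : ℝ} (hr : 0 < r) :
    Filter.Tendsto (fun y => r * Real.arctan (y / r)) Filter.atTop
      (nhds (r * (Real.pi / 2))) :=
  ((Real.tendsto_arctan_atTop.mono_right nhdsWithin_le_nhds).comp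
    (Filter.tendsto_id.atTop_div_const hr)).const_mul r

lemma integrable_blob_diff {r : ℝ} (hr : 0 < r) :
    Integrable fun z : ℝ² => r ^ 2 / (‖z‖ * (‖z‖ ^ 2 + r ^ 2)) := by
  refine integrable_radial (f := fun y => r ^ 2 / (y * (y ^ 2 + r ^ 2))) ?_
  rw [integrableOn_congr_fun (mul_blob_diff_eqOn r) measurableSet_Ioi]
  exact integrableOn_Ioi_deriv_of_nonneg' (fun y _ => hasDerivAt_mul_arctan hr y)
    (fun y _ => by positivity) (tendsto_mul_arctan hr)

lemma integral_blob_diff {r : ℝ} (hr : 0 < r) :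
    ∫ z : ℝ², r ^ 2 / (‖z‖ * (‖z‖ ^ 2 + r ^ 2)) = Real.pi ^ 2 * r := by
  rw [integral_radial fun y => r ^ 2 / (y * (y ^ 2 + r ^ 2)),
    setIntegral_congr_fun measurableSet_Ioi (mul_blob_diff_eqOn r),
    integral_Ioi_of_hasDerivAt_of_nonneg' (fun y _ => hasDerivAt_mul_arctan hr y)
    (fun y _ => by positivity) (tendsto_mul_arctan hr)]
  simp; ring

lemma continuous_inv_norm_sq_add {r : ℝ} (hr : 0 < r) :
    Continuous fun z : ℝ² => 1 / (‖z‖ ^ 2 + r ^ 2) :=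
  continuous_const.div (by fun_prop) fun z => by positivity

lemma integrable_indicator_inv_norm_sq_add {r : ℝ} (hr : 0 < r) (R : ℝ) :
    Integrable fun z : ℝ² => (Iio R).indicator (fun s : ℝ => 1 / (s ^ 2 + r ^ 2)) ‖z‖ := by
  have h : IntegrableOn (fun z : ℝ² => 1 / (‖z‖ ^ 2 + r ^ 2)) (Metric.ball 0 R) :=
    ((continuous_inv_norm_sq_add hr).continuousOn.integrableOn_compact
      (isCompact_closedBall 0 R)).mono_set Metric.ball_subset_closedBall
  refine ((integrable_indicator_iff Metric.isOpen_ball.measurableSet).2 h).congr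
    (.of_forall fun z => ?_)
  simp [indicator]

lemma integral_indicator_inv_norm_sq_add {r R : ℝ} (hr : 0 < r) (hR : 0 ≤ R) :
    ∫ z : ℝ², (Iio R).indicator (fun s : ℝ => 1 / (s ^ 2 + r ^ 2)) ‖z‖ =
      Real.pi * Real.log (1 + R ^ 2 / r ^ 2) := by
  have h : EqOn (fun y : ℝ => y * (Iio R).indicator (fun s : ℝ => 1 / (s ^ 2 + r ^ 2)) y)
      ((Iio R).indicator fun y => y / (y ^ 2 + r ^ 2)) (Ioi 0) := by
    intro y _
    by_cases hy : y ∈ Iio R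
    · simp [indicator_of_mem hy, div_eq_mul_inv]
    · simp [indicator_of_notMem hy]
  have hd : ∀ y ∈ uIcc 0 R,
      HasDerivAt (fun y => Real.log (y ^ 2 + r ^ 2) / 2) (y / (y ^ 2 + r ^ 2)) y := by
    intro y _
    have : y ^ 2 + r ^ 2 ≠ 0 := by positivity
    refine ((((hasDerivAt_pow 2 y).add_const (r ^ 2)).log this).div_const 2).congr_deriv ?_
    field_simp
    simp [mul_comm]
  have hc : Continuous fun y : ℝ => y / (y ^ 2 + r ^ 2) :=
    continuous_id.div (by fun_prop) fun z => by positivity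
  rw [integral_radial, setIntegral_congr_fun measurableSet_Ioi h,
    integral_indicator measurableSet_Iio, Measure.restrict_restrict measurableSet_Iio,
    Iio_inter_Ioi, ← integral_Ioc_eq_integral_Ioo, ← intervalIntegral.integral_of_le hR,
    intervalIntegral.integral_eq_sub_of_hasDerivAt hd (hc.intervalIntegrable _ _)]
  have e : 1 + R ^ 2 / r ^ 2 = (R ^ 2 + r ^ 2) / (0 ^ 2 + r ^ 2) := by
    field_simp; ring
  rw [e, Real.log_div (by positivity) (by positivity)]
  ring

/-- The kernel `z^⊥ / (|z|² + r²)`; for `r = 0` this is the Biot–Savart kernel up to a factor. -/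
def blobKernel (r : ℝ) (z : ℝ²) : ℝ² := (1 / (‖z‖ ^ 2 + r ^ 2)) • perp z

lemma measurable_blobKernel (r : ℝ) : Measurable (blobKernel r) := by
  have := continuous_perp.measurable
  unfold blobKernel
  fun_prop

lemma norm_blobKernel (r : ℝ) (z : ℝ²) : ‖blobKernel r z‖ = ‖z‖ / (‖z‖ ^ 2 + r ^ 2) := by
  rw [blobKernel, norm_smul, norm_perp, Real.norm_of_nonneg (by positivity)]
  ring

lemma norm_blobKernel_le (r : ℝ) (z : ℝ²) : ‖blobKernel r z‖ ≤ ‖z‖⁻¹ := by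
  rw [norm_blobKernel]
  rcases (norm_nonneg z).eq_or_lt with h | h
  · simp [← h]
  · rw [← one_div, div_le_div_iff₀ (by positivity) h]
    nlinarith [sq_nonneg r]

lemma norm_blobKernel_zero_sub (r : ℝ) (z : ℝ²) :
    ‖blobKernel 0 z - blobKernel r z‖ = r ^ 2 / (‖z‖ * (‖z‖ ^ 2 + r ^ 2)) := by
  rw [blobKernel, blobKernel, ← sub_smul, norm_smul, norm_perp]
  rcases (norm_nonneg z).eq_or_lt with h | h
  · simp [← h]
  · have h1 : 1 / (‖z‖ ^ 2 + 0 ^ 2) - 1 / (‖z‖ ^ 2 + r ^ 2) =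
        r ^ 2 / (‖z‖ ^ 2 * (‖z‖ ^ 2 + r ^ 2)) := by
      field_simp; ring
    rw [h1, Real.norm_of_nonneg (by positivity)]
    field_simp

lemma norm_blobKernel_sub_le {r : ℝ} (hr : 0 < r) (a b : ℝ²) :
    ‖blobKernel r a - blobKernel r b‖ ≤
      ‖a - b‖ * ((1 / (‖a‖ ^ 2 + r ^ 2) + 1 / (‖b‖ ^ 2 + r ^ 2)) / 2) := by
  set p := 1 / (‖a‖ ^ 2 + r ^ 2) with hp
  set q := 1 / (‖b‖ ^ 2 + r ^ 2) with hq
  have hp0 : 0 < p := by positivity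
  have hq0 : 0 < q := by positivity
  have hpa : p * (‖a‖ ^ 2 + r ^ 2) = 1 := by rw [hp]; field_simp
  have hqb : q * (‖b‖ ^ 2 + r ^ 2) = 1 := by rw [hq]; field_simp
  have h1 : blobKernel r a - blobKernel r b = perp (p • a - q • b) := by
    rw [perp_sub, perp_smul, perp_smul]; rfl
  rw [h1, norm_perp]
  refine abs_le_of_sq_le_sq' ?_ (by positivity) |>.2
  have e1 : ‖p • a - q • b‖ ^ 2 = p ^ 2 * ‖a‖ ^ 2 - 2 * (p * q * inner ℝ a b) + q ^ 2 * ‖b‖ ^ 2 := by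
    rw [norm_sub_sq_real, norm_smul, norm_smul, inner_smul_left, inner_smul_right, mul_pow, mul_pow]
    simp; ring
  have e2 : ‖a - b‖ ^ 2 = ‖a‖ ^ 2 - 2 * inner ℝ a b + ‖b‖ ^ 2 := norm_sub_sq_real a b
  have key : ‖p • a - q • b‖ ^ 2 ≤ ‖a - b‖ ^ 2 * (p * q) := by
    have e3 : ‖a - b‖ ^ 2 * (p * q) - ‖p • a - q • b‖ ^ 2 = r ^ 2 * (p - q) ^ 2 := by
      rw [e1, e2]
      have ha : p * ‖a‖ ^ 2 = 1 - p * r ^ 2 := by linarith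
      have hb : q * ‖b‖ ^ 2 = 1 - q * r ^ 2 := by linarith
      linear_combination (q - p) * ha + (p - q) * hb
    nlinarith [sq_nonneg (p - q), sq_nonneg r, mul_nonneg (sq_nonneg r) (sq_nonneg (p - q))]
  rw [mul_pow]
  refine key.trans (mul_le_mul_of_nonneg_left ?_ (sq_nonneg _))
  nlinarith [sq_nonneg (p - q)]

lemma continuous_blobKernel {r : ℝ} (hr : 0 < r) : Continuous (blobKernel r) :=
  (continuous_inv_norm_sq_add hr).smul continuous_perp

/-- The velocity field generated by `ω` through `blobKernel r`. -/
def blobVelocity (r : ℝ) (ω : ℝ² → ℝ) (x : ℝ²) : ℝ² :=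
  (1 / (2 * Real.pi)) • ∫ y, ω y • blobKernel r (x - y)

lemma biotSavart_eq_blobVelocity (ω : ℝ² → ℝ) : biotSavart ω = blobVelocity 0 ω := by
  ext1 x
  simp [biotSavart, blobVelocity, blobKernel, smul_smul, div_eq_mul_inv]

lemma blobVelocity_eq (r : ℝ) (ω : ℝ² → ℝ) (x : ℝ²) :
    blobVelocity r ω x = (1 / (2 * Real.pi)) • ∫ z, ω (x - z) • blobKernel r z := by
  rw [blobVelocity, ← integral_sub_left_eq_self (fun z => ω (x - z) • blobKernel r z) volume x]
  simp

section Estimates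

variable {ω : ℝ² → ℝ} {M A G : ℝ}

lemma Continuous.integrable_comp_sub_left (hc : Continuous ω) (hs : HasCompactSupport ω) (x : ℝ²) :
    Integrable fun z => |ω (x - z)| :=
  ((hc.integrable_of_hasCompactSupport hs).comp_sub_left x).abs

lemma integral_abs_comp_sub_left (ω : ℝ² → ℝ) (x : ℝ²) :
    ∫ z, |ω (x - z)| = ∫ z, |ω z| :=
  integral_sub_left_eq_self (fun z => |ω z|) volume x

lemma norm_smul_blobKernel_le (hM : ∀ x, |ω x| ≤ M) (r : ℝ) (x z : ℝ²) :
    ‖ω (x - z) • blobKernel r z‖ ≤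
      M * (Iio 1).indicator (fun s : ℝ => s⁻¹) ‖z‖ + |ω (x - z)| := by
  rw [norm_smul, Real.norm_eq_abs]
  have h := norm_blobKernel_le r z
  by_cases hz : ‖z‖ ∈ Iio (1 : ℝ)
  · rw [indicator_of_mem hz]
    have := mul_le_mul (hM (x - z)) h (norm_nonneg _) ((abs_nonneg _).trans (hM (x - z)))
    linarith [abs_nonneg (ω (x - z))]
  · rw [indicator_of_notMem hz]
    have h1 : ‖z‖⁻¹ ≤ 1 := inv_le_one_of_one_le₀ (not_lt.1 hz)
    nlinarith [abs_nonneg (ω (x - z)), norm_nonneg (blobKernel r z)]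

lemma integrable_smul_blobKernel (hc : Continuous ω) (hs : HasCompactSupport ω)
    (hM : ∀ x, |ω x| ≤ M) (r : ℝ) (x : ℝ²) :
    Integrable fun z => ω (x - z) • blobKernel r z := by
  refine Integrable.mono' (((integrable_indicator_inv_norm 1).const_mul M).add
    (hc.integrable_comp_sub_left hs x)) ?_ (.of_forall fun z => norm_smul_blobKernel_le hM r x z)
  exact (((hc.comp (continuous_const.sub continuous_id)).measurable).smul
    (measurable_blobKernel r)).aestronglyMeasurable

lemma norm_blobVelocity_le (hc : Continuous ω) (hs : HasCompactSupport ω)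
    (hM : ∀ x, |ω x| ≤ M) (hA : ∫ x, |ω x| ≤ A) (r : ℝ) (x : ℝ²) :
    ‖blobVelocity r ω x‖ ≤ M + A / (2 * Real.pi) := by
  have h : ‖∫ z, ω (x - z) • blobKernel r z‖ ≤ M * (2 * Real.pi * 1) + A := by
    refine (norm_integral_le_of_norm_le (((integrable_indicator_inv_norm 1).const_mul M).add
      (hc.integrable_comp_sub_left hs x))
      (.of_forall fun z => norm_smul_blobKernel_le hM r x z)).trans ?_
    rw [integral_add' ((integrable_indicator_inv_norm 1).const_mul M)
      (hc.integrable_comp_sub_left hs x), integral_const_mul,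
      integral_indicator_inv_norm zero_le_one, integral_abs_comp_sub_left]
    linarith
  have hpi := Real.pi_pos
  rw [blobVelocity_eq, norm_smul, Real.norm_of_nonneg (by positivity)]
  refine (mul_le_mul_of_nonneg_left h (by positivity)).trans (le_of_eq ?_)
  field_simp

lemma integrable_smul_blobKernel_sub (hc : Continuous ω) (hs : HasCompactSupport ω)
    (hM : ∀ x, |ω x| ≤ M) (r : ℝ) (x : ℝ²) :
    Integrable fun z => ω (x - z) • (blobKernel 0 z - blobKernel r z) := by
  simp_rw [smul_sub]
  exact (integrable_smul_blobKernel hc hs hM 0 x).sub (integrable_smul_blobKernel hc hs hM r x)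

lemma blobVelocity_zero_eq_add (hc : Continuous ω) (hs : HasCompactSupport ω)
    (hM : ∀ x, |ω x| ≤ M) (r : ℝ) (x : ℝ²) :
    blobVelocity 0 ω x = (1 / (2 * Real.pi)) • (∫ z, ω (x - z) • (blobKernel 0 z - blobKernel r z)) +
      blobVelocity r ω x := by
  rw [blobVelocity_eq, blobVelocity_eq, ← smul_add,
    ← integral_add (integrable_smul_blobKernel_sub hc hs hM r x)
      (integrable_smul_blobKernel hc hs hM r x)]
  simp [smul_sub]

lemma norm_blobVelocity_zero_sub_le (hc : Continuous ω) (hs : HasCompactSupport ω)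
    (hM : ∀ x, |ω x| ≤ M) {r : ℝ} (hr : 0 < r) (x : ℝ²) :
    ‖blobVelocity 0 ω x - blobVelocity r ω x‖ ≤ Real.pi / 2 * M * r := by
  rw [blobVelocity_zero_eq_add hc hs hM r, add_sub_cancel_right, norm_smul,
    Real.norm_of_nonneg (by positivity)]
  have h : ‖∫ z, ω (x - z) • (blobKernel 0 z - blobKernel r z)‖ ≤ M * (Real.pi ^ 2 * r) := by
    rw [← integral_blob_diff hr, ← integral_const_mul]
    refine norm_integral_le_of_norm_le ((integrable_blob_diff hr).const_mul M)
      (.of_forall fun z => ?_)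
    rw [norm_smul, norm_blobKernel_zero_sub]
    exact mul_le_mul_of_nonneg_right (hM _) (by positivity)
  have hpi := Real.pi_pos
  refine (mul_le_mul_of_nonneg_left h (by positivity)).trans (le_of_eq ?_)
  field_simp

lemma norm_integral_blobKernel_diff_sub_le (hc : Continuous ω) (hs : HasCompactSupport ω)
    (hM : ∀ x, |ω x| ≤ M) (hG : ∀ x y, |ω x - ω y| ≤ G * ‖x - y‖) {r : ℝ} (hr : 0 < r) (x y : ℝ²) :
    ‖(∫ z, ω (x - z) • (blobKernel 0 z - blobKernel r z)) -
      ∫ z, ω (y - z) • (blobKernel 0 z - blobKernel r z)‖ ≤ G * (Real.pi ^ 2 * r) * ‖x - y‖ := by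
  rw [← integral_sub (integrable_smul_blobKernel_sub hc hs hM r x)
    (integrable_smul_blobKernel_sub hc hs hM r y), ← integral_blob_diff hr, mul_right_comm,
    ← integral_const_mul]
  refine norm_integral_le_of_norm_le ((integrable_blob_diff hr).const_mul _)
      (.of_forall fun z => ?_)
  rw [← sub_smul, norm_smul, norm_blobKernel_zero_sub]
  refine mul_le_mul_of_nonneg_right ?_ (by positivity)
  simpa using hG (x - z) (y - z)

lemma integrable_abs_mul_inv_norm_sq_add (hc : Continuous ω) (hs : HasCompactSupport ω)
    {r : ℝ} (hr : 0 < r) (x : ℝ²) :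
    Integrable fun w => |ω w| * (1 / (‖x - w‖ ^ 2 + r ^ 2)) :=
  (hc.abs.mul ((continuous_inv_norm_sq_add hr).comp
    (continuous_const.sub continuous_id))).integrable_of_hasCompactSupport hs.abs.mul_right

lemma integral_abs_mul_inv_norm_sq_add_le (hc : Continuous ω) (hs : HasCompactSupport ω)
    (hM : ∀ x, |ω x| ≤ M) (hA : ∫ x, |ω x| ≤ A) {r R : ℝ} (hr : 0 < r) (hR : 0 < R) (x : ℝ²) :
    ∫ w, |ω w| * (1 / (‖x - w‖ ^ 2 + r ^ 2)) ≤
      M * (Real.pi * Real.log (1 + R ^ 2 / r ^ 2)) + A / R ^ 2 := by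
  have h1 : ∫ w, |ω w| * (1 / (‖x - w‖ ^ 2 + r ^ 2)) =
      ∫ z, |ω (x - z)| * (1 / (‖z‖ ^ 2 + r ^ 2)) := by
    rw [← integral_sub_left_eq_self (fun z => |ω (x - z)| * (1 / (‖z‖ ^ 2 + r ^ 2))) volume x]
    simp
  have i1 := (integrable_indicator_inv_norm_sq_add hr R).const_mul M
  have i2 := (hc.integrable_comp_sub_left hs x).div_const (R ^ 2)
  rw [h1]
  calc _ ≤ ∫ z, (M * (Iio R).indicator (fun s : ℝ => 1 / (s ^ 2 + r ^ 2)) ‖z‖ +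
        |ω (x - z)| / R ^ 2) := by
        refine integral_mono_of_nonneg (.of_forall fun z => by positivity) (i1.add i2)
          (.of_forall fun z => ?_)
        by_cases hz : ‖z‖ ∈ Iio R
        · simp only [indicator_of_mem hz]
          have := mul_le_mul_of_nonneg_right (hM (x - z))
            (show 0 ≤ 1 / (‖z‖ ^ 2 + r ^ 2) by positivity)
          have : 0 ≤ |ω (x - z)| / R ^ 2 := by positivity
          linarith
        · simp only [indicator_of_notMem hz, mul_zero, zero_add]
          rw [div_eq_mul_one_div |ω (x - z)|]
          refine mul_le_mul_of_nonneg_left ?_ (abs_nonneg _)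
          refine one_div_le_one_div_of_le (by positivity) ?_
          have : R ≤ ‖z‖ := not_lt.1 hz
          nlinarith [sq_nonneg r]
    _ = M * (Real.pi * Real.log (1 + R ^ 2 / r ^ 2)) + (∫ z, |ω z|) / R ^ 2 := by
        rw [integral_add i1 i2, integral_const_mul, integral_div, integral_abs_comp_sub_left,
          integral_indicator_inv_norm_sq_add hr hR.le]
    _ ≤ _ := by gcongr

lemma norm_integral_blobKernel_sub_le (hc : Continuous ω) (hs : HasCompactSupport ω)
    (hM : ∀ x, |ω x| ≤ M) (hA : ∫ x, |ω x| ≤ A) {r R : ℝ} (hr : 0 < r) (hR : 0 < R) (x y : ℝ²) :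
    ‖(∫ w, ω w • blobKernel r (x - w)) - ∫ w, ω w • blobKernel r (y - w)‖ ≤
      (M * (Real.pi * Real.log (1 + R ^ 2 / r ^ 2)) + A / R ^ 2) * ‖x - y‖ := by
  have hi : ∀ x, Integrable fun w => ω w • blobKernel r (x - w) := fun x =>
    (hc.smul ((continuous_blobKernel hr).comp
      (continuous_const.sub continuous_id))).integrable_of_hasCompactSupport hs.smul_right
  have ix := integrable_abs_mul_inv_norm_sq_add hc hs hr x
  have iy := integrable_abs_mul_inv_norm_sq_add hc hs hr y
  rw [← integral_sub (hi x) (hi y)]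
  refine (norm_integral_le_of_norm_le (((ix.add iy).div_const 2).mul_const ‖x - y‖)
    (.of_forall fun w => ?_)).trans ?_
  · rw [← smul_sub, norm_smul, Real.norm_eq_abs]
    have h := norm_blobKernel_sub_le hr (x - w) (y - w)
    rw [sub_sub_sub_cancel_right] at h
    refine (mul_le_mul_of_nonneg_left h (abs_nonneg _)).trans (le_of_eq ?_)
    simp only [Pi.add_apply]
    ring
  · rw [integral_mul_const, integral_div, integral_add' ix iy]
    refine mul_le_mul_of_nonneg_right ?_ (norm_nonneg _)
    linarith [integral_abs_mul_inv_norm_sq_add_le hc hs hM hA hr hR x,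
      integral_abs_mul_inv_norm_sq_add_le hc hs hM hA hr hR y]

lemma norm_biotSavart_sub_le (hc : Continuous ω) (hs : HasCompactSupport ω)
    (hM : ∀ x, |ω x| ≤ M) (hA : ∫ x, |ω x| ≤ A) (hG : ∀ x y, |ω x - ω y| ≤ G * ‖x - y‖)
    {r R : ℝ} (hr : 0 < r) (hR : 0 < R) (x y : ℝ²) :
    ‖biotSavart ω x - biotSavart ω y‖ ≤
      1 / (2 * Real.pi) * (G * (Real.pi ^ 2 * r) +
        (M * (Real.pi * Real.log (1 + R ^ 2 / r ^ 2)) + A / R ^ 2)) * ‖x - y‖ := by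
  rw [biotSavart_eq_blobVelocity, blobVelocity_zero_eq_add hc hs hM r x,
    blobVelocity_zero_eq_add hc hs hM r y, blobVelocity, blobVelocity, ← smul_add, ← smul_add,
    ← smul_sub, norm_smul, Real.norm_of_nonneg (by have := Real.pi_pos; positivity), mul_assoc]
  refine mul_le_mul_of_nonneg_left ?_ (by have := Real.pi_pos; positivity)
  rw [add_sub_add_comm, add_mul]
  exact (norm_add_le _ _).trans (add_le_add
    (norm_integral_blobKernel_diff_sub_le hc hs hM hG hr x y)
    (norm_integral_blobKernel_sub_le hc hs hM hA hr hR x y))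

/-- The universal constant in the logarithmic estimate for the velocity gradient. -/
def logLipConst : ℝ := (Real.pi ^ 2 + 1) / (2 * Real.pi) / Real.log 2 + 1

lemma logLipConst_pos : 0 < logLipConst := by
  have := Real.log_pos one_lt_two
  unfold logLipConst
  positivity

/-- Logarithmic estimate for the Lipschitz constant of the Biot–Savart velocity. -/
lemma norm_biotSavart_sub_le_log (hc : Continuous ω) (hs : HasCompactSupport ω)
    (hM : ∀ x, |ω x| ≤ M) (hA : ∫ x, |ω x| ≤ A) (hG : ∀ x y, |ω x - ω y| ≤ G * ‖x - y‖)
    {l : ℝ} (hM0 : 0 < M) (hA0 : 0 < A) (hG0 : 0 ≤ G) (hl : 0 < l) (hlAM : l ^ 2 = A / M ^ 3)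
    (x y : ℝ²) :
    ‖biotSavart ω x - biotSavart ω y‖ ≤
      logLipConst * M * Real.log (2 + l * G) * ‖x - y‖ := by
  have hpi := Real.pi_pos
  have hlog2 := Real.log_pos one_lt_two
  have hX : 0 ≤ l * G := by positivity
  have hr : 0 < l * M / (l * G + 1) := by positivity
  have hR : 0 < Real.sqrt (A / M) := by positivity
  refine (norm_biotSavart_sub_le hc hs hM hA hG hr hR x y).trans ?_
  refine mul_le_mul_of_nonneg_right ?_ (norm_nonneg _)
  rw [Real.sq_sqrt (by positivity)]
  have e1 : A / M / (l * M / (l * G + 1)) ^ 2 = (l * G + 1) ^ 2 := by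
    have hA' : A = l ^ 2 * M ^ 3 := by rw [hlAM]; field_simp
    rw [hA']; field_simp
  have e2 : A / (A / M) = M := by field_simp
  have e3 : G * (Real.pi ^ 2 * (l * M / (l * G + 1))) ≤ Real.pi ^ 2 * M := by
    rw [show G * (Real.pi ^ 2 * (l * M / (l * G + 1))) =
      Real.pi ^ 2 * M * (l * G / (l * G + 1)) by ring]
    exact mul_le_of_le_one_right (by positivity) ((div_le_one (by positivity)).2 (by linarith))
  have e4 : Real.log (1 + (l * G + 1) ^ 2) ≤ 2 * Real.log (2 + l * G) := by
    rw [show 2 * Real.log (2 + l * G) = Real.log ((2 + l * G) ^ 2) by rw [Real.log_pow]; norm_cast]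
    exact Real.log_le_log (by positivity) (by nlinarith)
  have e5 : Real.log 2 ≤ Real.log (2 + l * G) := Real.log_le_log two_pos (by linarith)
  rw [e1, e2]
  calc _ ≤ 1 / (2 * Real.pi) * (Real.pi ^ 2 * M +
        (M * (Real.pi * (2 * Real.log (2 + l * G))) + M)) := by gcongr
    _ = M * ((Real.pi ^ 2 + 1) / (2 * Real.pi) * 1 + Real.log (2 + l * G)) := by
        field_simp; ring
    _ ≤ M * ((Real.pi ^ 2 + 1) / (2 * Real.pi) * (Real.log (2 + l * G) / Real.log 2) +
        Real.log (2 + l * G)) := by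
        gcongr
        rwa [one_le_div hlog2]
    _ = _ := by rw [logLipConst]; field_simp

end Estimates

lemma integral_fderiv_perp_eq_zero {f : ℝ² → ℝ} (hf : ContDiff ℝ 1 f) (hs : HasCompactSupport f) :
    ∫ z, fderiv ℝ f z (perp z) = 0 := by
  have hfd : Continuous (fderiv ℝ f) := hf.continuous_fderiv (by norm_num)
  have coord : ∀ i j : Fin 2, i ≠ j →
      Integrable (fun z : ℝ² => z i * fderiv ℝ f z (EuclideanSpace.single j 1)) ∧
      ∫ z : ℝ², z i * fderiv ℝ f z (EuclideanSpace.single j 1) = 0 := by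
    intro i j hij
    have hp : ∀ z : ℝ², HasFDerivAt (fun z : ℝ² => z i) (EuclideanSpace.proj i : ℝ² →L[ℝ] ℝ) z :=
      fun z => (EuclideanSpace.proj i : ℝ² →L[ℝ] ℝ).hasFDerivAt
    have hp0 : ∀ z : ℝ², fderiv ℝ (fun z : ℝ² => z i) z (EuclideanSpace.single j 1) = 0 := by
      intro z
      rw [(hp z).fderiv]
      simp [hij]
    have hi : Integrable (fun z : ℝ² => z i * fderiv ℝ f z (EuclideanSpace.single j 1)) :=
      Continuous.integrable_of_hasCompactSupport (by fun_prop)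
        ((hs.fderiv_apply ℝ _).mul_left)
    refine ⟨hi, ?_⟩
    rw [integral_mul_fderiv_eq_neg_fderiv_mul_of_integrable]
    · simp [hp0]
    · simp [hp0]
    · exact hi
    · exact Continuous.integrable_of_hasCompactSupport
        ((by fun_prop : Continuous fun z : ℝ² => z i).mul hf.continuous) hs.mul_left
    · exact fun z _ => (hp z).differentiableAt
    · exact fun z _ => (hf.differentiable (by norm_num)) z
  have hdec : ∀ z : ℝ², fderiv ℝ f z (perp z) =
      z 0 * fderiv ℝ f z (EuclideanSpace.single 1 1) -
        z 1 * fderiv ℝ f z (EuclideanSpace.single 0 1) := by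
    intro z
    have : perp z = (z 0) • EuclideanSpace.single 1 (1 : ℝ) - (z 1) • EuclideanSpace.single 0 1 := by
      ext i; fin_cases i
      · simp [perp_apply_zero]
      · simp [perp_apply_one]
    rw [this]; simp
  simp_rw [hdec]
  rw [integral_sub (coord 0 1 (by decide)).1 (coord 1 0 (by decide)).1,
    (coord 0 1 (by decide)).2, (coord 1 0 (by decide)).2, sub_zero]

lemma inner_perp_self (z : ℝ²) : inner ℝ z (perp z) = 0 := by
  simp [PiLp.inner_apply, Fin.sum_univ_two, perp_apply_zero, perp_apply_one]
  ring

lemma integral_fderiv_blobKernel_eq_zero {f : ℝ² → ℝ} (hf : ContDiff ℝ 1 f)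
    (hs : HasCompactSupport f) {r : ℝ} (hr : 0 < r) :
    ∫ z, fderiv ℝ f z (blobKernel r z) = 0 := by
  have hq : ContDiff ℝ 1 fun z : ℝ² => (‖z‖ ^ 2 + r ^ 2)⁻¹ :=
    ((contDiff_norm_sq ℝ).add contDiff_const).inv fun z => by positivity
  rw [← integral_fderiv_perp_eq_zero (f := fun z => f z * (‖z‖ ^ 2 + r ^ 2)⁻¹) (hf.mul hq)
    hs.mul_right]
  congr 1 with z
  have hne : ‖z‖ ^ 2 + r ^ 2 ≠ 0 := by positivity
  have h1 : HasFDerivAt (fun z : ℝ² => ‖z‖ ^ 2 + r ^ 2) (2 • innerSL ℝ z) z :=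
    (hasStrictFDerivAt_norm_sq z).hasFDerivAt.add_const _
  have h2 := (hasDerivAt_inv hne).comp_hasFDerivAt z h1
  have h3 := ((hf.differentiable (by norm_num)) z).hasFDerivAt.mul h2
  have h4 : fderiv ℝ (fun z => f z * (‖z‖ ^ 2 + r ^ 2)⁻¹) z = _ := h3.fderiv
  rw [h4, blobKernel]
  simp [inner_perp_self]

lemma integral_fderiv_blobKernel_sub_eq_zero {f : ℝ² → ℝ} (hf : ContDiff ℝ 1 f)
    (hs : HasCompactSupport f) {r : ℝ} (hr : 0 < r) (y : ℝ²) :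
    ∫ x, fderiv ℝ f x (blobKernel r (x - y)) = 0 := by
  rw [← integral_add_right_eq_self _ y]
  simp only [add_sub_cancel_right]
  have hs' : HasCompactSupport fun z => f (z + y) :=
    hs.comp_homeomorph (Homeomorph.addRight y)
  rw [← integral_fderiv_blobKernel_eq_zero (f := fun z => f (z + y))
    (hf.comp (contDiff_id.add contDiff_const)) hs' hr]
  simp_rw [fderiv_comp_add_right]

section

variable {f ω : ℝ² → ℝ}

lemma continuous_blobVelocity (hc : Continuous ω) (hs : HasCompactSupport ω) {r : ℝ} (hr : 0 < r) :
    Continuous (blobVelocity r ω) := by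
  obtain ⟨M, hM⟩ := hc.bounded_above_of_compact_support hs
  have h : LipschitzWith _ fun x => ∫ w, ω w • blobKernel r (x - w) :=
    LipschitzWith.of_dist_le' fun x y => by
      rw [dist_eq_norm, dist_eq_norm]
      exact norm_integral_blobKernel_sub_le hc hs hM le_rfl hr one_pos x y
  exact h.continuous.const_smul (1 / (2 * Real.pi))

lemma integral_fderiv_blobVelocity_eq_zero (hf : ContDiff ℝ 1 f) (hfs : HasCompactSupport f)
    (hc : Continuous ω) (hs : HasCompactSupport ω) {r : ℝ} (hr : 0 < r) :
    ∫ x, fderiv ℝ f x (blobVelocity r ω x) = 0 := by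
  have hfd : Continuous (fderiv ℝ f) := hf.continuous_fderiv (by norm_num)
  have hK := continuous_blobKernel hr
  have h1 : ∀ x, fderiv ℝ f x (blobVelocity r ω x) =
      1 / (2 * Real.pi) * ∫ y, ω y * fderiv ℝ f x (blobKernel r (x - y)) := by
    intro x
    have hi : Integrable fun w => ω w • blobKernel r (x - w) :=
      (hc.smul (hK.comp
        (continuous_const.sub continuous_id))).integrable_of_hasCompactSupport hs.smul_right
    rw [blobVelocity, map_smul, ← ContinuousLinearMap.integral_comp_comm _ hi]
    simp
  simp_rw [h1]
  rw [integral_const_mul, integral_integral_swap_of_hasCompactSupport]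
  · simp_rw [integral_const_mul, integral_fderiv_blobKernel_sub_eq_zero hf hfs hr]
    simp
  · exact (hc.comp continuous_snd).mul ((hfd.comp continuous_fst).clm_apply
      (hK.comp (continuous_fst.sub continuous_snd)))
  · refine HasCompactSupport.intro ((hfs.fderiv ℝ).isCompact.prod hs.isCompact) ?_
    rintro ⟨x, y⟩ hxy
    simp only [mem_prod, not_and_or] at hxy
    rcases hxy with h | h
    · simp [Function.uncurry, image_eq_zero_of_notMem_tsupport h]
    · simp [Function.uncurry, image_eq_zero_of_notMem_tsupport h]

/-- The Biot–Savart velocity is weakly divergence free. -/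
lemma integral_fderiv_biotSavart_eq_zero (hf : ContDiff ℝ 1 f) (hfs : HasCompactSupport f)
    (hc : Continuous ω) (hs : HasCompactSupport ω) :
    ∫ x, fderiv ℝ f x (biotSavart ω x) = 0 := by
  rw [biotSavart_eq_blobVelocity]
  by_cases hi : Integrable fun x => fderiv ℝ f x (blobVelocity 0 ω x)
  swap
  · exact integral_undef hi
  obtain ⟨M, hM⟩ := hc.bounded_above_of_compact_support hs
  have hM0 : 0 ≤ M := (norm_nonneg _).trans (hM 0)
  have hfd : Continuous (fderiv ℝ f) := hf.continuous_fderiv (by norm_num)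
  have hfi : Integrable fun x => ‖fderiv ℝ f x‖ :=
    (hfd.integrable_of_hasCompactSupport (hfs.fderiv ℝ)).norm
  set c := (∫ x, ‖fderiv ℝ f x‖) * (Real.pi / 2 * M) with hcdef
  have hc0 : 0 ≤ c := mul_nonneg (integral_nonneg fun _ => norm_nonneg _)
    (by have := Real.pi_pos; positivity)
  have hbound : ∀ r > 0, ‖∫ x, fderiv ℝ f x (blobVelocity 0 ω x)‖ ≤ c * r := by
    intro r hr
    have hir : Integrable fun x => fderiv ℝ f x (blobVelocity r ω x) := by
      refine Continuous.integrable_of_hasCompactSupport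
        (hfd.clm_apply (continuous_blobVelocity hc hs hr)) ?_
      refine HasCompactSupport.intro (hfs.fderiv ℝ).isCompact fun x hx => ?_
      simp [image_eq_zero_of_notMem_tsupport hx]
    have e : ∫ x, fderiv ℝ f x (blobVelocity 0 ω x) =
        ∫ x, (fderiv ℝ f x (blobVelocity 0 ω x) - fderiv ℝ f x (blobVelocity r ω x)) := by
      rw [integral_sub hi hir, integral_fderiv_blobVelocity_eq_zero hf hfs hc hs hr, sub_zero]
    rw [e, hcdef, mul_assoc, ← integral_mul_const]
    refine norm_integral_le_of_norm_le (hfi.mul_const _) (.of_forall fun x => ?_)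
    rw [← map_sub]
    exact (ContinuousLinearMap.le_opNorm _ _).trans (mul_le_mul_of_nonneg_left
      (norm_blobVelocity_zero_sub_le hc hs hM hr x) (norm_nonneg _))
  by_contra hne
  have hpos := norm_pos_iff.2 hne
  have h := hbound (‖∫ x, fderiv ℝ f x (blobVelocity 0 ω x)‖ / (c + 1)) (by positivity)
  rw [← mul_div_assoc, le_div_iff₀ (by positivity)] at h
  linarith

/-- A velocity field on `[a, b]` which is continuous in time, bounded by `V` and
`K`-Lipschitz in space. -/
structure IsLipschitzVelocity (v : ℝ → ℝ² → ℝ²) (a b V K : ℝ) : Prop where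
  continuousOn : ∀ x, ContinuousOn (fun t => v t x) (Icc a b)
  norm_le : ∀ t ∈ Icc a b, ∀ x, ‖v t x‖ ≤ V
  norm_sub_le : ∀ t ∈ Icc a b, ∀ x y, ‖v t x - v t y‖ ≤ K * ‖x - y‖

/-- `θ` solves the transport equation with velocity `v` on the time interval `[a, b]`. -/
def IsTransported (θ : ℝ → ℝ² → ℝ) (v : ℝ → ℝ² → ℝ²) (a b : ℝ) : Prop :=
  ∀ t ∈ Icc a b, ∀ x, deriv (fun s => θ s x) t + fderiv ℝ (θ t) x (v t x) = 0

section Characteristics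

variable {v : ℝ → ℝ² → ℝ²} {θ : ℝ → ℝ² → ℝ} {a b V K : ℝ}

lemma IsLipschitzVelocity.exists_characteristic (hv : IsLipschitzVelocity v a b V K) {t₀ : ℝ}
    (ht₀ : t₀ ∈ Icc a b) (x : ℝ²) :
    ∃ γ : ℝ → ℝ², γ t₀ = x ∧ ∀ t ∈ Icc a b, HasDerivWithinAt γ (v t (γ t)) (Icc a b) t := by
  have hV : 0 ≤ V := (norm_nonneg _).trans (hv.norm_le t₀ ht₀ x)
  have hab : 0 ≤ b - a := by linarith [ht₀.1, ht₀.2]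
  have hpl : IsPicardLindelof v (⟨t₀, ht₀⟩ : Icc a b) x (Real.toNNReal (V * (b - a))) 0
      (Real.toNNReal V) (Real.toNNReal K) := by
    refine ⟨fun t ht => ?_, fun y _ => hv.continuousOn y, fun t ht y _ => ?_, ?_⟩
    · refine (LipschitzWith.of_dist_le' fun y z => ?_).lipschitzOnWith
      rw [dist_eq_norm, dist_eq_norm]
      exact hv.norm_sub_le t ht y z
    · rw [Real.coe_toNNReal _ hV]
      exact hv.norm_le t ht y
    · rw [Real.coe_toNNReal _ hV, Real.coe_toNNReal _ (mul_nonneg hV hab)]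
      simp only [NNReal.coe_zero, sub_zero]
      exact mul_le_mul_of_nonneg_left (max_le (by linarith [ht₀.1]) (by linarith [ht₀.2])) hV
  exact hpl.exists_eq_forall_mem_Icc_hasDerivWithinAt₀

lemma IsTransported.apply_characteristic_eq (hθ : ContDiff ℝ 1 fun p : ℝ × ℝ² => θ p.1 p.2)
    (h : IsTransported θ v a b) {γ : ℝ → ℝ²}
    (hγ : ∀ t ∈ Icc a b, HasDerivWithinAt γ (v t (γ t)) (Icc a b) t) {s t : ℝ}
    (hs : s ∈ Icc a b) (ht : t ∈ Icc a b) : θ t (γ t) = θ s (γ s) := by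
  have hd : ∀ t ∈ Icc a b, HasDerivWithinAt (fun t => θ t (γ t)) 0 (Icc a b) t := by
    intro t ht
    set F : ℝ × ℝ² → ℝ := fun p => θ p.1 p.2
    have hF : HasFDerivAt F (fderiv ℝ F (t, γ t)) (t, γ t) :=
      ((hθ.differentiable (by norm_num)) _).hasFDerivAt
    have h1 : HasDerivAt (fun s => θ s (γ t)) (fderiv ℝ F (t, γ t) (1, 0)) t :=
      hF.comp_hasDerivAt (f := fun s => (s, γ t)) t ((hasDerivAt_id t).prodMk (hasDerivAt_const t (γ t)))
    have h2 : HasFDerivAt (θ t) ((fderiv ℝ F (t, γ t)).comp (ContinuousLinearMap.inr ℝ ℝ ℝ²))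
        (γ t) := hF.comp (γ t) (hasFDerivAt_prodMk_right t (γ t))
    have h3 : HasDerivWithinAt (fun t => θ t (γ t)) (fderiv ℝ F (t, γ t) (1, v t (γ t)))
        (Icc a b) t :=
      hF.comp_hasDerivWithinAt (f := fun s => (s, γ s)) t ((hasDerivWithinAt_id t _).prodMk (hγ t ht))
    have h4 := h t ht (γ t)
    rw [h1.deriv, h2.fderiv] at h4
    have h5 : ((1 : ℝ), v t (γ t)) = (1, 0) + (0, v t (γ t)) := by simp
    rw [h5, map_add] at h3
    simp only [ContinuousLinearMap.comp_apply, ContinuousLinearMap.inr_apply] at h4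
    rwa [h4] at h3
  have := Convex.norm_image_sub_le_of_norm_hasDerivWithin_le hd (C := 0) (by simp)
    (convex_Icc a b) hs ht
  simpa [sub_eq_zero] using this

lemma IsTransported.exists_apply_eq (hθ : ContDiff ℝ 1 fun p : ℝ × ℝ² => θ p.1 p.2)
    (h : IsTransported θ v a b) (hv : IsLipschitzVelocity v a b V K) {s t : ℝ}
    (hs : s ∈ Icc a b) (ht : t ∈ Icc a b) (x : ℝ²) :
    ∃ y, ‖x - y‖ ≤ V * |t - s| ∧ θ t x = θ s y := by
  obtain ⟨γ, rfl, hγ⟩ := hv.exists_characteristic ht x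
  refine ⟨γ s, ?_, h.apply_characteristic_eq hθ hγ hs ht⟩
  simpa using Convex.norm_image_sub_le_of_norm_hasDerivWithin_le hγ
    (fun r hr => hv.norm_le r hr _) (convex_Icc a b) hs ht

lemma norm_characteristic_sub_le {L : ℝ → ℝ} (hL : Continuous L)
    (hvL : ∀ t ∈ Icc a b, ∀ x y, ‖v t x - v t y‖ ≤ L t * ‖x - y‖) (hab : a ≤ b)
    {γ₁ γ₂ : ℝ → ℝ²} (h₁ : ∀ t ∈ Icc a b, HasDerivWithinAt γ₁ (v t (γ₁ t)) (Icc a b) t)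
    (h₂ : ∀ t ∈ Icc a b, HasDerivWithinAt γ₂ (v t (γ₂ t)) (Icc a b) t) :
    ‖γ₁ a - γ₂ a‖ ≤ ‖γ₁ b - γ₂ b‖ * Real.exp (∫ s in a..b, L s) := by
  set h : ℝ → ℝ := fun t => ‖γ₁ t - γ₂ t‖ ^ 2 * Real.exp (2 * ∫ s in a..t, L s) with hh
  have hd : ∀ t ∈ Icc a b, HasDerivWithinAt h
      (2 * inner ℝ (γ₁ t - γ₂ t) (v t (γ₁ t) - v t (γ₂ t)) * Real.exp (2 * ∫ s in a..t, L s) +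
        ‖γ₁ t - γ₂ t‖ ^ 2 * (Real.exp (2 * ∫ s in a..t, L s) * (2 * L t))) (Icc a b) t := by
    intro t ht
    have hI : HasDerivAt (fun t => ∫ s in a..t, L s) (L t) t :=
      intervalIntegral.integral_hasDerivAt_right (hL.intervalIntegrable _ _)
        (hL.stronglyMeasurableAtFilter _ _) hL.continuousAt
    exact ((h₁ t ht).sub (h₂ t ht)).norm_sq.mul (hI.const_mul 2).exp.hasDerivWithinAt
  have hmono : MonotoneOn h (Icc a b) := by
    refine monotoneOn_of_deriv_nonneg (convex_Icc a b) (fun t ht => (hd t ht).continuousWithinAt)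
      ?_ ?_
    · intro t ht
      exact ((hd t (interior_subset ht)).mono interior_subset).differentiableWithinAt
    · intro t ht
      rw [interior_Icc] at ht
      have ht' := Ioo_subset_Icc_self ht
      rw [((hd t ht').hasDerivAt (Icc_mem_nhds ht.1 ht.2)).deriv]
      have e := Real.exp_pos (2 * ∫ s in a..t, L s)
      have h1 := abs_real_inner_le_norm (γ₁ t - γ₂ t) (v t (γ₁ t) - v t (γ₂ t))
      have h2 := mul_le_mul_of_nonneg_left (hvL t ht' (γ₁ t) (γ₂ t)) (norm_nonneg (γ₁ t - γ₂ t))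
      have h3 := neg_abs_le (inner ℝ (γ₁ t - γ₂ t) (v t (γ₁ t) - v t (γ₂ t)))
      have h4 : 0 ≤ inner ℝ (γ₁ t - γ₂ t) (v t (γ₁ t) - v t (γ₂ t)) +
          ‖γ₁ t - γ₂ t‖ ^ 2 * L t := by nlinarith
      nlinarith [mul_nonneg h4 e.le]
  have hle := hmono (left_mem_Icc.2 hab) (right_mem_Icc.2 hab) hab
  simp only [hh, intervalIntegral.integral_same, mul_zero, Real.exp_zero, mul_one] at hle
  refine abs_le_of_sq_le_sq' (hle.trans (le_of_eq ?_)) (by positivity) |>.2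
  rw [mul_pow, ← Real.exp_nat_mul]
  norm_cast

lemma IsTransported.abs_sub_le (hθ : ContDiff ℝ 1 fun p : ℝ × ℝ² => θ p.1 p.2)
    (h : IsTransported θ v a b) (hv : IsLipschitzVelocity v a b V K) {L : ℝ → ℝ}
    (hL : Continuous L) (hvL : ∀ t ∈ Icc a b, ∀ x y, ‖v t x - v t y‖ ≤ L t * ‖x - y‖)
    (hab : a ≤ b) {G : ℝ} (hG : 0 ≤ G) (hθG : ∀ x y, |θ a x - θ a y| ≤ G * ‖x - y‖) (x y : ℝ²) :
    |θ b x - θ b y| ≤ G * Real.exp (∫ s in a..b, L s) * ‖x - y‖ := by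
  have ha := left_mem_Icc.2 hab
  have hb := right_mem_Icc.2 hab
  obtain ⟨γ₁, rfl, h₁⟩ := hv.exists_characteristic hb x
  obtain ⟨γ₂, rfl, h₂⟩ := hv.exists_characteristic hb y
  rw [h.apply_characteristic_eq hθ h₁ ha hb, h.apply_characteristic_eq hθ h₂ ha hb]
  refine (hθG _ _).trans ?_
  have := mul_le_mul_of_nonneg_left (norm_characteristic_sub_le hL hvL hab h₁ h₂) hG
  linarith

end Characteristics

/-- On the time interval `[a, b]`, the function `θ` vanishes outside the ball of radius `R`. -/
def IsSupportedIn (θ : ℝ → ℝ² → ℝ) (a b R : ℝ) : Prop :=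
  ∀ t ∈ Icc a b, ∀ x, R < ‖x‖ → θ t x = 0

section Regularity

variable {θ : ℝ → ℝ² → ℝ} {a b R : ℝ}

lemma hasDerivAt_time (hθ : ContDiff ℝ 1 fun p : ℝ × ℝ² => θ p.1 p.2) (t : ℝ) (x : ℝ²) :
    HasDerivAt (fun s => θ s x) (fderiv ℝ (fun p : ℝ × ℝ² => θ p.1 p.2) (t, x) (1, 0)) t :=
  (((hθ.differentiable (by norm_num)) (t, x)).hasFDerivAt).comp_hasDerivAt
    (f := fun s => (s, x)) t ((hasDerivAt_id t).prodMk (hasDerivAt_const t x))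

lemma hasFDerivAt_space (hθ : ContDiff ℝ 1 fun p : ℝ × ℝ² => θ p.1 p.2) (t : ℝ) (x : ℝ²) :
    HasFDerivAt (θ t) ((fderiv ℝ (fun p : ℝ × ℝ² => θ p.1 p.2) (t, x)).comp
      (ContinuousLinearMap.inr ℝ ℝ ℝ²)) x :=
  (((hθ.differentiable (by norm_num)) (t, x)).hasFDerivAt).comp x (hasFDerivAt_prodMk_right t x)

lemma continuous_deriv_time (hθ : ContDiff ℝ 1 fun p : ℝ × ℝ² => θ p.1 p.2) :
    Continuous fun p : ℝ × ℝ² => deriv (fun s => θ s p.2) p.1 := by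
  have h : (fun p : ℝ × ℝ² => deriv (fun s => θ s p.2) p.1) =
      fun p => fderiv ℝ (fun p : ℝ × ℝ² => θ p.1 p.2) p (1, 0) :=
    funext fun p => (hasDerivAt_time hθ p.1 p.2).deriv
  rw [h]
  exact (hθ.continuous_fderiv (by norm_num)).clm_apply continuous_const

lemma continuous_fderiv_space (hθ : ContDiff ℝ 1 fun p : ℝ × ℝ² => θ p.1 p.2) :
    Continuous fun p : ℝ × ℝ² => fderiv ℝ (θ p.1) p.2 := by
  have h : (fun p : ℝ × ℝ² => fderiv ℝ (θ p.1) p.2) = fun p =>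
      (fderiv ℝ (fun p : ℝ × ℝ² => θ p.1 p.2) p).comp (ContinuousLinearMap.inr ℝ ℝ ℝ²) :=
    funext fun p => (hasFDerivAt_space hθ p.1 p.2).fderiv
  rw [h]
  exact (hθ.continuous_fderiv (by norm_num)).clm_comp continuous_const

lemma contDiff_slice (hθ : ContDiff ℝ 1 fun p : ℝ × ℝ² => θ p.1 p.2) (t : ℝ) :
    ContDiff ℝ 1 (θ t) :=
  hθ.comp (contDiff_const.prodMk contDiff_id)

lemma continuous_time (hθ : ContDiff ℝ 1 fun p : ℝ × ℝ² => θ p.1 p.2) (x : ℝ²) :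
    Continuous fun t => θ t x :=
  hθ.continuous.comp (continuous_id.prodMk continuous_const)

lemma IsSupportedIn.tsupport_subset (hR : IsSupportedIn θ a b R) {t : ℝ} (ht : t ∈ Icc a b) :
    tsupport (θ t) ⊆ Metric.closedBall 0 R := by
  refine closure_minimal (fun x hx => ?_) Metric.isClosed_closedBall
  rw [mem_closedBall_zero_iff]
  by_contra h
  exact hx (hR t ht x (not_le.1 h))

lemma IsSupportedIn.hasCompactSupport (hR : IsSupportedIn θ a b R) {t : ℝ} (ht : t ∈ Icc a b) :
    HasCompactSupport (θ t) :=
  (isCompact_closedBall 0 R).of_isClosed_subset (isClosed_tsupport _) (hR.tsupport_subset ht)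

lemma IsSupportedIn.exists_bound (hR : IsSupportedIn θ a b R)
    (hθ : ContDiff ℝ 1 fun p : ℝ × ℝ² => θ p.1 p.2) :
    ∃ M, ∀ t ∈ Icc a b, ∀ x, |θ t x| ≤ M := by
  obtain ⟨M, hM⟩ := (isCompact_Icc.prod (isCompact_closedBall (0 : ℝ²) R)).exists_bound_of_continuousOn
    (s := Icc a b ×ˢ Metric.closedBall (0 : ℝ²) R) hθ.continuous.continuousOn
  refine ⟨max M 0, fun t ht x => ?_⟩
  by_cases hx : ‖x‖ ≤ R
  · exact (hM (t, x) ⟨ht, mem_closedBall_zero_iff.2 hx⟩).trans (le_max_left _ _)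
  · rw [hR t ht x (not_le.1 hx)]; simp

lemma IsSupportedIn.fderiv_eq_zero (hR : IsSupportedIn θ a b R) {t : ℝ} (ht : t ∈ Icc a b)
    {x : ℝ²} (hx : R < ‖x‖) : fderiv ℝ (θ t) x = 0 := by
  refine image_eq_zero_of_notMem_tsupport fun h => ?_
  have := mem_closedBall_zero_iff.1 (hR.tsupport_subset ht (tsupport_fderiv_subset ℝ h))
  linarith

lemma abs_sub_le_of_fderiv_le {f : ℝ² → ℝ} (hf : Differentiable ℝ f) {G : ℝ}
    (hG : ∀ x, ‖fderiv ℝ f x‖ ≤ G) (x y : ℝ²) : |f x - f y| ≤ G * ‖x - y‖ :=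
  convex_univ.norm_image_sub_le_of_norm_fderiv_le (fun z _ => hf z) (fun z _ => hG z)
    (mem_univ y) (mem_univ x)

lemma IsSupportedIn.exists_lipschitz (hR : IsSupportedIn θ a b R)
    (hθ : ContDiff ℝ 1 fun p : ℝ × ℝ² => θ p.1 p.2) :
    ∃ G, ∀ t ∈ Icc a b, ∀ x y, |θ t x - θ t y| ≤ G * ‖x - y‖ := by
  obtain ⟨G, hG⟩ := (isCompact_Icc.prod (isCompact_closedBall (0 : ℝ²) R)).exists_bound_of_continuousOn
    (s := Icc a b ×ˢ Metric.closedBall (0 : ℝ²) R) (continuous_fderiv_space hθ).continuousOn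
  refine ⟨max G 0, fun t ht => abs_sub_le_of_fderiv_le
    ((contDiff_slice hθ t).differentiable (by norm_num)) fun x => ?_⟩
  by_cases hx : ‖x‖ ≤ R
  · exact (hG (t, x) ⟨ht, mem_closedBall_zero_iff.2 hx⟩).trans (le_max_left _ _)
  · rw [hR.fderiv_eq_zero ht (not_le.1 hx)]; simp

lemma IsSupportedIn.continuousOn_biotSavart (hR : IsSupportedIn θ a b R)
    (hθ : ContDiff ℝ 1 fun p : ℝ × ℝ² => θ p.1 p.2) (x : ℝ²) :
    ContinuousOn (fun t => biotSavart (θ t) x) (Icc a b) := by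
  obtain ⟨M, hM⟩ := hR.exists_bound hθ
  simp_rw [biotSavart_eq_blobVelocity, blobVelocity_eq]
  refine ContinuousOn.const_smul ?_ (1 / (2 * Real.pi))
  refine continuousOn_of_dominated (bound := fun z =>
    M * (Iio (R + ‖x‖ + 1)).indicator (fun s : ℝ => s⁻¹) ‖z‖) (fun t ht => ?_)
    (fun t ht => .of_forall fun z => ?_) ((integrable_indicator_inv_norm _).const_mul M)
    (.of_forall fun z => ?_)
  · exact (integrable_smul_blobKernel (contDiff_slice hθ t).continuous (hR.hasCompactSupport ht)
      (hM t ht) 0 x).aestronglyMeasurable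
  · by_cases hz : ‖z‖ ∈ Iio (R + ‖x‖ + 1)
    · rw [indicator_of_mem hz, norm_smul]
      exact mul_le_mul (hM t ht _) (norm_blobKernel_le 0 z) (norm_nonneg _)
        ((abs_nonneg _).trans (hM t ht 0))
    · have h1 : R + ‖x‖ + 1 ≤ ‖z‖ := not_lt.1 hz
      have h2 : ‖z‖ - ‖x‖ ≤ ‖x - z‖ := by rw [norm_sub_rev]; exact norm_sub_norm_le z x
      rw [indicator_of_notMem hz, hR t ht (x - z) (by linarith)]
      simp
  · exact ((continuous_time hθ (x - z)).smul continuous_const).continuousOn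

lemma IsSupportedIn.exists_isLipschitzVelocity (hR : IsSupportedIn θ a b R)
    (hθ : ContDiff ℝ 1 fun p : ℝ × ℝ² => θ p.1 p.2) {M A : ℝ}
    (hM : ∀ t ∈ Icc a b, ∀ x, |θ t x| ≤ M) (hA : ∀ t ∈ Icc a b, ∫ x, |θ t x| ≤ A) :
    ∃ K, IsLipschitzVelocity (fun t => biotSavart (θ t)) a b (M + A / (2 * Real.pi)) K := by
  obtain ⟨G, hG⟩ := hR.exists_lipschitz hθ
  have hc := fun t => (contDiff_slice hθ t).continuous
  refine ⟨_, hR.continuousOn_biotSavart hθ, fun t ht x => ?_, fun t ht x y =>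
    norm_biotSavart_sub_le (hc t) (hR.hasCompactSupport ht) (hM t ht) (hA t ht) (hG t ht)
      one_pos one_pos x y⟩
  rw [biotSavart_eq_blobVelocity]
  exact norm_blobVelocity_le (hc t) (hR.hasCompactSupport ht) (hM t ht) (hA t ht) 0 x

lemma IsLipschitzVelocity.neg {v : ℝ → ℝ² → ℝ²} {V K : ℝ} (h : IsLipschitzVelocity v a b V K) :
    IsLipschitzVelocity (fun t x => -v t x) a b V K where
  continuousOn x := (h.continuousOn x).neg
  norm_le t ht x := by rw [norm_neg]; exact h.norm_le t ht x
  norm_sub_le t ht x y := by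
    rw [neg_sub_neg, norm_sub_rev]; exact h.norm_sub_le t ht x y

end Regularity

section Conservation

variable {θ : ℝ → ℝ² → ℝ} {v : ℝ → ℝ² → ℝ²} {a b R : ℝ}

/-- The velocity field `v` is weakly divergence free at each time of `[a, b]`. -/
def IsWeaklyDivFree (v : ℝ → ℝ² → ℝ²) (a b : ℝ) : Prop :=
  ∀ t ∈ Icc a b, ∀ f : ℝ² → ℝ, ContDiff ℝ 1 f → HasCompactSupport f →
    ∫ x, fderiv ℝ f x (v t x) = 0

lemma hasDerivAt_setIntegral_comp (hθ : ContDiff ℝ 1 fun p : ℝ × ℝ² => θ p.1 p.2) {φ : ℝ → ℝ}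
    (hφ : ContDiff ℝ 1 φ) (R t : ℝ) :
    HasDerivAt (fun t => ∫ x in Metric.closedBall (0 : ℝ²) R, φ (θ t x))
      (∫ x in Metric.closedBall (0 : ℝ²) R, deriv φ (θ t x) * deriv (fun s => θ s x) t) t := by
  have hF' : Continuous fun p : ℝ × ℝ² => deriv φ (θ p.1 p.2) * deriv (fun s => θ s p.2) p.1 :=
    ((hφ.continuous_deriv (by norm_num)).comp hθ.continuous).mul (continuous_deriv_time hθ)
  have hF : ∀ t, Continuous fun x => φ (θ t x) := fun t =>
    hφ.continuous.comp (contDiff_slice hθ t).continuous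
  obtain ⟨C, hC⟩ := ((isCompact_Icc (a := t - 1) (b := t + 1)).prod
    (isCompact_closedBall (0 : ℝ²) R)).exists_bound_of_continuousOn hF'.continuousOn
  refine (hasDerivAt_integral_of_dominated_loc_of_deriv_le (bound := fun _ => C)
    (F' := fun t x => deriv φ (θ t x) * deriv (fun s => θ s x) t)
    (Icc_mem_nhds (sub_one_lt t) (lt_add_one t))
    (.of_forall fun s => (hF s).aestronglyMeasurable) ?_ ?_ ?_ ?_ ?_).2
  · exact (hF t).continuousOn.integrableOn_compact (isCompact_closedBall 0 R)
  · exact (hF'.comp (continuous_const.prodMk continuous_id)).aestronglyMeasurable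
  · refine (ae_restrict_iff' Metric.isClosed_closedBall.measurableSet).2
      (.of_forall fun x hx s hs => ?_)
    exact hC (s, x) ⟨hs, hx⟩
  · exact integrableOn_const (isCompact_closedBall (0 : ℝ²) R).measure_lt_top.ne
  · refine .of_forall fun x s _ => ?_
    have h1 := hasDerivAt_time hθ s x
    have h2 := ((hφ.differentiable (by norm_num)) (θ s x)).hasDerivAt.comp s h1
    rwa [← h1.deriv] at h2

lemma IsTransported.setIntegral_comp_eq (hθ : ContDiff ℝ 1 fun p : ℝ × ℝ² => θ p.1 p.2)
    (h : IsTransported θ v a b) (hv : IsWeaklyDivFree v a b) (hR : IsSupportedIn θ a b R)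
    {φ : ℝ → ℝ} (hφ : ContDiff ℝ 1 φ) (hφ0 : φ 0 = 0) {s t : ℝ} (hs : s ∈ Icc a b)
    (ht : t ∈ Icc a b) :
    ∫ x in Metric.closedBall (0 : ℝ²) R, φ (θ t x) =
      ∫ x in Metric.closedBall (0 : ℝ²) R, φ (θ s x) := by
  have hd : ∀ t ∈ Icc a b, HasDerivWithinAt
      (fun t => ∫ x in Metric.closedBall (0 : ℝ²) R, φ (θ t x)) 0 (Icc a b) t := by
    intro t ht
    have h1 := (hasDerivAt_setIntegral_comp hθ hφ R t).hasDerivWithinAt (s := Icc a b)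
    have hd1 : ∀ x, fderiv ℝ (fun y => φ (θ t y)) x = deriv φ (θ t x) • fderiv ℝ (θ t) x := by
      intro x
      have h2 := ((hφ.differentiable (by norm_num)) (θ t x)).hasDerivAt.comp_hasFDerivAt x
        (((contDiff_slice hθ t).differentiable (by norm_num)) x).hasFDerivAt
      exact h2.fderiv
    have h2 : ∀ x, deriv φ (θ t x) * deriv (fun s => θ s x) t =
        -(fderiv ℝ (fun y => φ (θ t y)) x (v t x)) := by
      intro x
      have h3 := h t ht x
      rw [hd1]
      simp only [smul_apply, smul_eq_mul]
      linear_combination deriv φ (θ t x) * h3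
    simp_rw [h2] at h1
    rw [integral_neg, setIntegral_eq_integral_of_forall_compl_eq_zero, hv t ht
      (fun y => φ (θ t y)) (hφ.comp (contDiff_slice hθ t)) ((hR.hasCompactSupport ht).comp_left hφ0), neg_zero] at h1
    · exact h1
    · intro x hx
      rw [mem_closedBall_zero_iff, not_le] at hx
      rw [hd1, hR.fderiv_eq_zero ht hx]
      simp
  have := Convex.norm_image_sub_le_of_norm_hasDerivWithin_le hd (C := 0) (by simp)
    (convex_Icc a b) hs ht
  simpa [sub_eq_zero] using this

lemma IsTransported.integral_abs_le (hθ : ContDiff ℝ 1 fun p : ℝ × ℝ² => θ p.1 p.2)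
    (h : IsTransported θ v a b) (hv : IsWeaklyDivFree v a b) (hR : IsSupportedIn θ a b R)
    {s t : ℝ} (hs : s ∈ Icc a b) (ht : t ∈ Icc a b) : ∫ x, |θ t x| ≤ ∫ x, |θ s x| := by
  have hset : ∀ t ∈ Icc a b, ∫ x in Metric.closedBall (0 : ℝ²) R, |θ t x| = ∫ x, |θ t x| := by
    intro t ht
    refine setIntegral_eq_integral_of_forall_compl_eq_zero fun x hx => ?_
    rw [mem_closedBall_zero_iff, not_le] at hx
    simp [hR t ht x hx]
  rw [← hset t ht, ← hset s hs]
  have hfin : volume (Metric.closedBall (0 : ℝ²) R) ≠ ⊤ :=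
    (isCompact_closedBall (0 : ℝ²) R).measure_lt_top.ne
  set B := volume.real (Metric.closedBall (0 : ℝ²) R)
  have hB : 0 ≤ B := measureReal_nonneg
  have key : ∀ ε > 0, ∫ x in Metric.closedBall (0 : ℝ²) R, |θ t x| ≤
      (∫ x in Metric.closedBall (0 : ℝ²) R, |θ s x|) + ε * B := by
    intro ε hε
    set φ : ℝ → ℝ := fun y => Real.sqrt (y ^ 2 + ε ^ 2) - ε
    have hφ : ContDiff ℝ 1 φ :=
      (((contDiff_id.pow 2).add contDiff_const).sqrt fun y => by positivity).sub contDiff_const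
    have hφ0 : φ 0 = 0 := by simp [φ, Real.sqrt_sq hε.le]
    have hint : ∀ f : ℝ² → ℝ, Continuous f → IntegrableOn f (Metric.closedBall (0 : ℝ²) R) :=
      fun f hf => hf.continuousOn.integrableOn_compact (isCompact_closedBall 0 R)
    have hc := fun t => (contDiff_slice hθ t).continuous
    have hφc : ∀ t, Continuous fun x => φ (θ t x) := fun t => hφ.continuous.comp (hc t)
    have hle1 : ∀ y, |y| ≤ φ y + ε := fun y => by
      simp only [φ, sub_add_cancel]
      exact Real.abs_le_sqrt (by nlinarith)
    have hle2 : ∀ y, φ y ≤ |y| := fun y => by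
      simp only [φ]
      rw [sub_le_iff_le_add, Real.sqrt_le_left (by positivity)]
      nlinarith [abs_nonneg y, sq_abs y]
    calc _ ≤ ∫ x in Metric.closedBall (0 : ℝ²) R, (φ (θ t x) + ε) :=
          integral_mono (hint _ (hc t).abs)
            ((hint _ (hφc t)).add (integrableOn_const hfin))
            fun x => hle1 _
      _ = (∫ x in Metric.closedBall (0 : ℝ²) R, φ (θ t x)) + ε * B := by
          rw [integral_add (hint _ (hφc t)) (integrableOn_const hfin)]
          simp [B, mul_comm]
      _ = (∫ x in Metric.closedBall (0 : ℝ²) R, φ (θ s x)) + ε * B := by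
          rw [h.setIntegral_comp_eq hθ hv hR hφ hφ0 hs ht]
      _ ≤ _ := add_le_add (integral_mono (hint _ (hφc s)) (hint _ (hc s).abs)
          fun x => hle2 _) le_rfl
  refine le_of_forall_pos_le_add fun δ hδ => (key (δ / (B + 1)) (by positivity)).trans ?_
  gcongr
  rw [div_mul_eq_mul_div, div_le_iff₀ (by positivity)]
  nlinarith

end Conservation

/-- Bounds on the `L^∞` norm, the `L¹` norm and the radius of the support of `f`. -/
structure SizeBound (f : ℝ² → ℝ) (M A ρ : ℝ) : Prop where
  abs_le : ∀ x, |f x| ≤ M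
  integral_le : ∫ x, |f x| ≤ A
  eq_zero : ∀ x, ρ < ‖x‖ → f x = 0

lemma sizeBound_of_abs_le {f : ℝ² → ℝ} {M ρ : ℝ} (hM : ∀ x, |f x| ≤ M)
    (h0 : ∀ x, ρ < ‖x‖ → f x = 0) :
    SizeBound f M (M * volume.real (Metric.closedBall (0 : ℝ²) ρ)) ρ := by
  refine ⟨hM, ?_, h0⟩
  rw [← setIntegral_eq_integral_of_forall_compl_eq_zero (s := Metric.closedBall (0 : ℝ²) ρ)]
  · refine (Real.le_norm_self _).trans
      (norm_setIntegral_le_of_norm_le_const (isCompact_closedBall (0 : ℝ²) ρ).measure_lt_top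
      fun x _ => ?_)
    rw [Real.norm_eq_abs, abs_abs]
    exact hM x
  · intro x hx
    rw [mem_closedBall_zero_iff, not_le] at hx
    rw [h0 x hx, abs_zero]

lemma exists_nat_bound {f : ℝ² → ℝ} (hc : Continuous f) (hs : HasCompactSupport f) :
    ∃ n : ℕ, (∀ x, |f x| ≤ n) ∧ ∀ x, (n : ℝ) < ‖x‖ → f x = 0 := by
  obtain ⟨M, hM⟩ := hc.bounded_above_of_compact_support hs
  obtain ⟨ρ, hρ⟩ := hs.isCompact.isBounded.subset_closedBall 0
  obtain ⟨n, hn⟩ := exists_nat_ge (max M ρ)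
  refine ⟨n, fun x => (hM x).trans ((le_max_left _ _).trans hn), fun x hx => ?_⟩
  refine image_eq_zero_of_notMem_tsupport fun h => ?_
  have := mem_closedBall_zero_iff.1 (hρ h)
  linarith [le_max_right M ρ]

lemma IsTransported.sizeBound {θ : ℝ → ℝ² → ℝ} {v : ℝ → ℝ² → ℝ²} {a b R V K M A ρ : ℝ}
    (hθ : ContDiff ℝ 1 fun p : ℝ × ℝ² => θ p.1 p.2) (h : IsTransported θ v a b)
    (hv : IsLipschitzVelocity v a b V K) (hdiv : IsWeaklyDivFree v a b)
    (hR : IsSupportedIn θ a b R) {s t : ℝ} (hs : s ∈ Icc a b) (ht : t ∈ Icc a b)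
    (hb : SizeBound (θ s) M A ρ) : SizeBound (θ t) M A (ρ + V * |t - s|) := by
  refine ⟨fun x => ?_, (h.integral_abs_le hθ hdiv hR hs ht).trans hb.integral_le,
    fun x hx => ?_⟩
  · obtain ⟨y, -, hy⟩ := h.exists_apply_eq hθ hv hs ht x
    rw [hy]
    exact hb.abs_le y
  · obtain ⟨y, hxy, hy⟩ := h.exists_apply_eq hθ hv hs ht x
    rw [hy]
    refine hb.eq_zero y ?_
    linarith [norm_sub_norm_le x y]

/-- `C¹` solutions with compact support of the unscreened right-handed system on `[a, b]`. -/
structure IsSolutionOn (σp σm : ℝ → ℝ² → ℝ) (a b : ℝ) : Prop where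
  contDiff_pos : ContDiff ℝ 1 fun p : ℝ × ℝ² => σp p.1 p.2
  contDiff_neg : ContDiff ℝ 1 fun p : ℝ × ℝ² => σm p.1 p.2
  hasCompactSupport_pos : ∀ t, HasCompactSupport (σp t)
  hasCompactSupport_neg : ∀ t, HasCompactSupport (σm t)
  transported_pos : IsTransported σp (fun t x => -biotSavart (σm t) x) a b
  transported_neg : IsTransported σm (fun t => biotSavart (σp t)) a b

namespace IsSolutionOn

variable {σp σm : ℝ → ℝ² → ℝ} {a b : ℝ}

lemma mono (h : IsSolutionOn σp σm a b) {c d : ℝ} (hcd : Icc c d ⊆ Icc a b) :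
    IsSolutionOn σp σm c d where
  contDiff_pos := h.contDiff_pos
  contDiff_neg := h.contDiff_neg
  hasCompactSupport_pos := h.hasCompactSupport_pos
  hasCompactSupport_neg := h.hasCompactSupport_neg
  transported_pos t ht := h.transported_pos t (hcd ht)
  transported_neg t ht := h.transported_neg t (hcd ht)

lemma isWeaklyDivFree_biotSavart_pos (h : IsSolutionOn σp σm a b) :
    IsWeaklyDivFree (fun t => biotSavart (σp t)) a b := fun t _ _ hf hfs =>
  integral_fderiv_biotSavart_eq_zero hf hfs (contDiff_slice h.contDiff_pos t).continuous
    (h.hasCompactSupport_pos t)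

lemma isWeaklyDivFree_neg_biotSavart_neg (h : IsSolutionOn σp σm a b) :
    IsWeaklyDivFree (fun t x => -biotSavart (σm t) x) a b := fun t _ f hf hfs => by
  simp only [map_neg]
  rw [integral_neg, integral_fderiv_biotSavart_eq_zero hf hfs
    (contDiff_slice h.contDiff_neg t).continuous (h.hasCompactSupport_neg t), neg_zero]

lemma sizeBound (h : IsSolutionOn σp σm a b) {R : ℝ} (hp : IsSupportedIn σp a b R)
    (hm : IsSupportedIn σm a b R) {s t M A ρ : ℝ} (hs : s ∈ Icc a b) (ht : t ∈ Icc a b)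
    (bp : SizeBound (σp s) M A ρ) (bm : SizeBound (σm s) M A ρ) :
    SizeBound (σp t) M A (ρ + (M + A / (2 * Real.pi)) * |t - s|) ∧
      SizeBound (σm t) M A (ρ + (M + A / (2 * Real.pi)) * |t - s|) := by
  obtain ⟨Mp, hMp⟩ := hp.exists_bound h.contDiff_pos
  obtain ⟨Mm, hMm⟩ := hm.exists_bound h.contDiff_neg
  have dp := h.isWeaklyDivFree_biotSavart_pos
  have dm := h.isWeaklyDivFree_neg_biotSavart_neg
  have Ap := fun r (hr : r ∈ Icc a b) =>
    (h.transported_pos.integral_abs_le h.contDiff_pos dm hp hs hr).trans bp.integral_le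
  have Am := fun r (hr : r ∈ Icc a b) =>
    (h.transported_neg.integral_abs_le h.contDiff_neg dp hm hs hr).trans bm.integral_le
  obtain ⟨Kp, hKp⟩ := hp.exists_isLipschitzVelocity h.contDiff_pos hMp Ap
  obtain ⟨Km, hKm⟩ := hm.exists_isLipschitzVelocity h.contDiff_neg hMm Am
  have Bp := fun r (hr : r ∈ Icc a b) =>
    (h.transported_pos.sizeBound h.contDiff_pos hKm.neg dm hp hs hr bp).abs_le
  have Bm := fun r (hr : r ∈ Icc a b) =>
    (h.transported_neg.sizeBound h.contDiff_neg hKp dp hm hs hr bm).abs_le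
  obtain ⟨Kp', hKp'⟩ := hp.exists_isLipschitzVelocity h.contDiff_pos Bp Ap
  obtain ⟨Km', hKm'⟩ := hm.exists_isLipschitzVelocity h.contDiff_neg Bm Am
  exact ⟨h.transported_pos.sizeBound h.contDiff_pos hKm'.neg dm hp hs ht bp,
    h.transported_neg.sizeBound h.contDiff_neg hKp' dp hm hs ht bm⟩

end IsSolutionOn

section UniformSupport

variable {σp σm : ℝ → ℝ² → ℝ} {a b : ℝ}

/-- Both functions vanish at time `t` outside the ball of radius `ρ`. -/
def VanishOutside (σp σm : ℝ → ℝ² → ℝ) (t ρ : ℝ) : Prop :=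
  ∀ x, ρ < ‖x‖ → σp t x = 0 ∧ σm t x = 0

lemma VanishOutside.mono {t ρ ρ' : ℝ} (h : VanishOutside σp σm t ρ) (hρ : ρ ≤ ρ') :
    VanishOutside σp σm t ρ' := fun x hx => h x (hρ.trans_lt hx)

/-- Times near which the supports of both functions are uniformly bounded. -/
def locallyBoundedTimes (σp σm : ℝ → ℝ² → ℝ) (a b : ℝ) : Set ℝ :=
  {t | ∃ ρ, ∀ᶠ s in nhds t, s ∈ Icc a b → VanishOutside σp σm s ρ}

lemma isOpen_locallyBoundedTimes : IsOpen (locallyBoundedTimes σp σm a b) := by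
  have : locallyBoundedTimes σp σm a b =
      ⋃ ρ, {t | ∀ᶠ s in nhds t, s ∈ Icc a b → VanishOutside σp σm s ρ} := by
    ext t; simp [locallyBoundedTimes]
  rw [this]
  exact isOpen_iUnion fun ρ => isOpen_setOfPred_eventually_nhds

lemma exists_vanishOutside_of_subset {k : Set ℝ} (hk : IsCompact k) (hkab : k ⊆ Icc a b)
    (h : k ⊆ locallyBoundedTimes σp σm a b) :
    ∃ ρ, ∀ t ∈ k, VanishOutside σp σm t ρ := by
  refine hk.induction_on (p := fun s => ∃ ρ, ∀ t ∈ s, VanishOutside σp σm t ρ)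
    ⟨0, by simp⟩ (fun s t hst ⟨ρ, hρ⟩ => ⟨ρ, fun r hr => hρ r (hst hr)⟩) ?_ ?_
  · rintro s t ⟨ρ, hρ⟩ ⟨ρ', hρ'⟩
    refine ⟨max ρ ρ', fun r hr => ?_⟩
    rcases hr with hr | hr
    · exact (hρ r hr).mono (le_max_left _ _)
    · exact (hρ' r hr).mono (le_max_right _ _)
  · intro t ht
    obtain ⟨ρ, hρ⟩ := h ht
    refine ⟨{s | s ∈ Icc a b → VanishOutside σp σm s ρ} ∩ k,
      Filter.inter_mem (mem_nhdsWithin_of_mem_nhds hρ) self_mem_nhdsWithin, ρ, ?_⟩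
    exact fun s hs => hs.1 (hkab hs.2)

lemma IsSolutionOn.vanishOutside (h : IsSolutionOn σp σm a b) {s t M A ρ R : ℝ}
    (hs : s ∈ Icc a b) (ht : t ∈ Icc a b) (hR : ∀ r ∈ uIcc s t, VanishOutside σp σm r R)
    (bp : SizeBound (σp s) M A ρ) (bm : SizeBound (σm s) M A ρ) :
    VanishOutside σp σm t (ρ + (M + A / (2 * Real.pi)) * (b - a)) := by
  have h' : IsSolutionOn σp σm (min s t) (max s t) := h.mono (uIcc_subset_Icc hs ht)
  have := h'.sizeBound (R := R) (fun r hr x hx => (hR r hr x hx).1)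
    (fun r hr x hx => (hR r hr x hx).2) left_mem_uIcc right_mem_uIcc bp bm
  have hM : 0 ≤ M := (abs_nonneg _).trans (bp.abs_le 0)
  have hA : 0 ≤ A := (integral_nonneg fun x => abs_nonneg _).trans bp.integral_le
  have hle : ρ + (M + A / (2 * Real.pi)) * |t - s| ≤ ρ + (M + A / (2 * Real.pi)) * (b - a) := by
    gcongr
    exact abs_le.2 ⟨by linarith [hs.2, ht.1], by linarith [hs.1, ht.2]⟩
  exact VanishOutside.mono (fun x hx => ⟨this.1.eq_zero x hx, this.2.eq_zero x hx⟩) hle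

lemma IsSolutionOn.exists_nat_bound (h : IsSolutionOn σp σm a b) (t : ℝ) :
    ∃ n : ℕ, VanishOutside σp σm t n ∧ ∀ x, |σp t x| ≤ n ∧ |σm t x| ≤ n := by
  obtain ⟨n, h1, h2⟩ := _root_.exists_nat_bound (contDiff_slice h.contDiff_pos t).continuous
    (h.hasCompactSupport_pos t)
  obtain ⟨m, h3, h4⟩ := _root_.exists_nat_bound (contDiff_slice h.contDiff_neg t).continuous
    (h.hasCompactSupport_neg t)
  have hn : (n : ℝ) ≤ (max n m : ℕ) := by exact_mod_cast le_max_left n m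
  have hm : (m : ℝ) ≤ (max n m : ℕ) := by exact_mod_cast le_max_right n m
  exact ⟨max n m, fun x hx => ⟨h2 x (hn.trans_lt hx), h4 x (hm.trans_lt hx)⟩,
    fun x => ⟨(h1 x).trans hn, (h3 x).trans hm⟩⟩

lemma IsSolutionOn.vanishOutside_of_nat_bound (h : IsSolutionOn σp σm a b) {s t R : ℝ} {n : ℕ}
    (hs : s ∈ Icc a b) (ht : t ∈ Icc a b) (hR : ∀ r ∈ uIcc s t, VanishOutside σp σm r R)
    (hn : VanishOutside σp σm s n) (hn' : ∀ x, |σp s x| ≤ n ∧ |σm s x| ≤ n) :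
    VanishOutside σp σm t (n + (n + n * volume.real (Metric.closedBall (0 : ℝ²) n) /
      (2 * Real.pi)) * (b - a)) :=
  h.vanishOutside hs ht hR (sizeBound_of_abs_le (fun x => (hn' x).1) fun x hx => (hn x hx).1)
    (sizeBound_of_abs_le (fun x => (hn' x).2) fun x hx => (hn x hx).2)

lemma IsSolutionOn.vanishOutside_of_locallyBounded (h : IsSolutionOn σp σm a b) {s t : ℝ} {n : ℕ}
    (hs : s ∈ Icc a b) (ht : t ∈ Icc a b)
    (hst : ∀ r ∈ uIcc s t, r ≠ s → r ∈ locallyBoundedTimes σp σm a b)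
    (hn : VanishOutside σp σm s n) (hn' : ∀ x, |σp s x| ≤ n ∧ |σm s x| ≤ n) :
    VanishOutside σp σm t (n + (n + n * volume.real (Metric.closedBall (0 : ℝ²) n) /
      (2 * Real.pi)) * (b - a)) := by
  have hsub := uIcc_subset_Icc hs ht
  obtain ⟨m, hm, hm'⟩ := h.exists_nat_bound t
  set ρ : ℝ := m + (m + m * volume.real (Metric.closedBall (0 : ℝ²) m) /
      (2 * Real.pi)) * (b - a)
  refine h.vanishOutside_of_nat_bound (R := max n ρ) hs ht (fun r hr => ?_) hn hn'
  by_cases hrs : r = s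
  · rw [hrs]; exact hn.mono (le_max_left _ _)
  refine VanishOutside.mono ?_ (le_max_right _ _)
  have hrt : uIcc t r ⊆ uIcc s t := by
    rw [uIcc_comm t r]
    exact uIcc_subset_uIcc hr right_mem_uIcc
  obtain ⟨R, hR⟩ := exists_vanishOutside_of_subset (σp := σp) (σm := σm) (a := a) (b := b)
    (isCompact_uIcc (a := t) (b := r)) (hrt.trans hsub) fun q hq => hst q (hrt hq) fun hqs => by
      subst hqs
      rcases mem_uIcc.1 hr with h1 | h1 <;> rcases mem_uIcc.1 hq with h2 | h2 <;>
        exact hrs (by linarith)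
  exact h.vanishOutside_of_nat_bound ht (hsub hr) hR hm hm'

lemma IsSolutionOn.subset_locallyBoundedTimes (h : IsSolutionOn σp σm a b) :
    Icc a b ⊆ locallyBoundedTimes σp σm a b := by
  set k : Set ℝ := Icc a b \ locallyBoundedTimes σp σm a b with hk
  have hkc : IsCompact k := isCompact_Icc.diff isOpen_locallyBoundedTimes
  rw [← sdiff_eq_empty, ← hk]
  by_contra hne
  have : Nonempty k := (nonempty_iff_ne_empty.2 hne).to_subtype
  have : CompactSpace k := isCompact_iff_compactSpace.1 hkc
  set F : ℕ → Set k := fun n => {t | VanishOutside σp σm t n ∧ ∀ x, |σp t x| ≤ n ∧ |σm t x| ≤ n}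
  have hct : ∀ x, Continuous fun t : k => σp t x := fun x =>
    (continuous_time h.contDiff_pos x).comp continuous_subtype_val
  have hct' : ∀ x, Continuous fun t : k => σm t x := fun x =>
    (continuous_time h.contDiff_neg x).comp continuous_subtype_val
  have hF : ∀ n, IsClosed (F n) := by
    intro n
    simp only [F, VanishOutside, ofPred_and, ofPred_forall]
    refine IsClosed.inter ?_ ?_
    · exact isClosed_iInter fun x => isClosed_iInter fun _ =>
        (isClosed_eq (hct x) continuous_const).inter (isClosed_eq (hct' x) continuous_const)
    · exact isClosed_iInter fun x =>
        (isClosed_le (hct x).abs continuous_const).inter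
          (isClosed_le (hct' x).abs continuous_const)
  obtain ⟨n, t₀, ht₀⟩ := nonempty_interior_of_iUnion_of_closed hF
    (eq_univ_of_forall fun t => mem_iUnion.2 (h.exists_nat_bound t))
  obtain ⟨ε, hε, hball⟩ := Metric.mem_nhds_iff.1 (mem_interior_iff_mem_nhds.1 ht₀)
  refine t₀.2.2 ⟨n + (n + n * volume.real (Metric.closedBall (0 : ℝ²) n) / (2 * Real.pi)) * (b - a),
    Metric.eventually_nhds_iff.2 ⟨ε, hε, fun t htε ht => ?_⟩⟩
  obtain ⟨s, ⟨hsk, hst⟩, hdist⟩ := (hkc.inter_right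
    (isCompact_uIcc (a := (t₀ : ℝ)) (b := t)).isClosed).exists_infDist_eq_dist ⟨t₀, t₀.2, left_mem_uIcc⟩ t
  have hsF : (⟨s, hsk⟩ : k) ∈ F n := by
    refine hball ?_
    rw [Metric.mem_ball, Subtype.dist_eq]
    refine lt_of_le_of_lt ?_ htε
    rw [Real.dist_eq, Real.dist_eq]
    exact abs_sub_left_of_mem_uIcc hst
  refine h.vanishOutside_of_locallyBounded hsk.1 ht (fun r hr hrs => ?_) hsF.1 hsF.2
  by_contra hrl
  have hr0 : r ∈ uIcc (t₀ : ℝ) t := uIcc_subset_uIcc hst right_mem_uIcc hr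
  have hrk : r ∈ k := ⟨uIcc_subset_Icc hsk.1 ht hr, hrl⟩
  have hle := Metric.infDist_le_dist_of_mem (x := t) (show r ∈ k ∩ _ from ⟨hrk, hr0⟩)
  rw [hdist, Real.dist_eq, Real.dist_eq] at hle
  rcases mem_uIcc.1 hr with h1 | h1
  · rw [abs_of_nonneg (by linarith), abs_of_nonneg (by linarith)] at hle
    exact hrs (by linarith)
  · rw [abs_of_nonpos (by linarith), abs_of_nonpos (by linarith)] at hle
    exact hrs (by linarith)

lemma IsSolutionOn.exists_isSupportedIn (h : IsSolutionOn σp σm a b) :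
    ∃ R, IsSupportedIn σp a b R ∧ IsSupportedIn σm a b R := by
  obtain ⟨R, hR⟩ := exists_vanishOutside_of_subset isCompact_Icc Subset.rfl
    h.subset_locallyBoundedTimes
  exact ⟨R, fun t ht x hx => (hR t ht x hx).1, fun t ht x hx => (hR t ht x hx).2⟩

end UniformSupport

section Norms

lemma abs_le_toReal_eLpNorm_top {g : ℝ² → ℝ} (hc : Continuous g) (hs : HasCompactSupport g)
    (x : ℝ²) : |g x| ≤ (eLpNorm g ⊤ volume).toReal := by
  have hcl : IsClosed {x | ‖g x‖ₑ ≤ eLpNorm g ⊤ volume} := isClosed_le hc.enorm continuous_const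
  have hd : Dense {x | ‖g x‖ₑ ≤ eLpNorm g ⊤ volume} := by
    rw [eLpNorm_exponent_top]
    exact Measure.dense_of_ae ae_le_eLpNormEssSup
  have hx : x ∈ {x | ‖g x‖ₑ ≤ eLpNorm g ⊤ volume} := by
    rw [← hcl.closure_eq, hd.closure_eq]; trivial
  have := ENNReal.toReal_mono (hc.memLp_top_of_hasCompactSupport hs volume).eLpNorm_ne_top hx
  simpa using this

lemma abs_le_lInfNorm {f : ℝ² → ℝ} (hc : Continuous f) (hs : HasCompactSupport f) (x : ℝ²) :
    |f x| ≤ lInfNorm f := abs_le_toReal_eLpNorm_top hc hs x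

lemma norm_fderiv_le_gradLInfNorm {f : ℝ² → ℝ} (hf : ContDiff ℝ 1 f) (hs : HasCompactSupport f)
    (x : ℝ²) : ‖fderiv ℝ f x‖ ≤ gradLInfNorm f :=
  (Real.le_norm_self _).trans (abs_le_toReal_eLpNorm_top (g := fun x => ‖fderiv ℝ f x‖)
    (hf.continuous_fderiv (by norm_num)).norm (hs.fderiv (𝕜 := ℝ)).norm x)

lemma gradLInfNorm_le {f : ℝ² → ℝ} {G : ℝ} (hG : ∀ x, ‖fderiv ℝ f x‖ ≤ G) :
    gradLInfNorm f ≤ G := by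
  refine ENNReal.toReal_le_of_le_ofReal ((norm_nonneg _).trans (hG 0)) ?_
  rw [eLpNorm_exponent_top]
  exact eLpNormEssSup_le_of_ae_bound (.of_forall fun x => by rw [norm_norm]; exact hG x)

lemma integral_abs_eq_l1Norm {f : ℝ² → ℝ} (hc : Continuous f) : ∫ x, |f x| = l1Norm f := by
  rw [l1Norm, eLpNorm_one_eq_lintegral_enorm]
  exact integral_norm_eq_lintegral_enorm hc.aestronglyMeasurable

lemma lInfNorm_pos {f : ℝ² → ℝ} (hc : Continuous f) (hs : HasCompactSupport f) (hf : f ≠ 0) :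
    0 < lInfNorm f := by
  obtain ⟨x, hx⟩ := Function.ne_iff.1 hf
  exact (abs_pos.2 hx).trans_le (abs_le_lInfNorm hc hs x)

lemma l1Norm_pos {f : ℝ² → ℝ} (hc : Continuous f) (hs : HasCompactSupport f) (hf : f ≠ 0) :
    0 < l1Norm f := by
  obtain ⟨x, hx⟩ := Function.ne_iff.1 hf
  rw [← integral_abs_eq_l1Norm hc]
  exact hc.abs.integral_pos_of_hasCompactSupport_nonneg_nonzero hs.norm (fun _ => abs_nonneg _)
    (abs_ne_zero.2 hx)

end Norms

lemma le_mul_exp_of_le_add_integral {y : ℝ → ℝ} (hy : Continuous y) {y₀ κ T : ℝ} (hκ : 0 ≤ κ)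
    (h : ∀ t ∈ Icc 0 T, y t ≤ y₀ + ∫ s in (0 : ℝ)..t, κ * y s) {t : ℝ} (ht : t ∈ Icc 0 T) :
    y t ≤ y₀ * Real.exp (κ * t) := by
  set Y : ℝ → ℝ := fun t => y₀ + ∫ s in (0 : ℝ)..t, κ * y s
  have hκy : Continuous fun s => κ * y s := continuous_const.mul hy
  have hd : ∀ t, HasDerivAt (fun t => Y t * Real.exp (-(κ * t)))
      (κ * y t * Real.exp (-(κ * t)) + Y t * (Real.exp (-(κ * t)) * -(κ * 1))) t := fun t =>
    ((intervalIntegral.integral_hasDerivAt_right (hκy.intervalIntegrable _ _)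
      (hκy.stronglyMeasurableAtFilter _ _) hκy.continuousAt).const_add y₀).mul
      ((hasDerivAt_id t).const_mul κ).neg.exp
  have hanti : AntitoneOn (fun t => Y t * Real.exp (-(κ * t))) (Icc 0 T) := by
    refine antitoneOn_of_deriv_nonpos (convex_Icc 0 T)
      (fun t _ => (hd t).continuousAt.continuousWithinAt)
      (fun t _ => (hd t).differentiableAt.differentiableWithinAt) fun t ht' => ?_
    rw [(hd t).deriv]
    have h1 := h t (interior_subset ht')
    have h2 : 0 ≤ κ * (Y t - y t) * Real.exp (-(κ * t)) :=
      mul_nonneg (mul_nonneg hκ (sub_nonneg.2 h1)) (Real.exp_pos _).le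
    linarith
  have h0 := hanti (left_mem_Icc.2 (ht.1.trans ht.2)) ht ht.1
  simp only [Y, intervalIntegral.integral_same, add_zero, mul_zero, neg_zero, Real.exp_zero,
    mul_one] at h0
  rw [Real.exp_neg, ← div_eq_mul_inv, div_le_iff₀ (Real.exp_pos _)] at h0
  exact (h t ht).trans h0

/-- The maximal norm of the gradient of `θ t` on the ball of radius `R`. -/
def maxGradient (θ : ℝ → ℝ² → ℝ) (R t : ℝ) : ℝ :=
  sSup ((fun x => ‖fderiv ℝ (θ t) x‖) '' Metric.closedBall 0 R)

section MaxGradient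

variable {θ : ℝ → ℝ² → ℝ} {a b R t : ℝ}

lemma continuous_maxGradient (hθ : ContDiff ℝ 1 fun p : ℝ × ℝ² => θ p.1 p.2) (R : ℝ) :
    Continuous (maxGradient θ R) :=
  (isCompact_closedBall (0 : ℝ²) R).continuous_sSup (f := fun t x => ‖fderiv ℝ (θ t) x‖)
    (continuous_fderiv_space hθ).norm

lemma maxGradient_nonneg : 0 ≤ maxGradient θ R t :=
  Real.sSup_nonneg (by rintro _ ⟨x, -, rfl⟩; exact norm_nonneg _)

lemma maxGradient_le {G : ℝ} (hG : 0 ≤ G) (h : ∀ x, ‖fderiv ℝ (θ t) x‖ ≤ G) :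
    maxGradient θ R t ≤ G :=
  Real.sSup_le (by rintro _ ⟨x, -, rfl⟩; exact h x) hG

lemma IsSupportedIn.norm_fderiv_le_maxGradient (hR : IsSupportedIn θ a b R)
    (hθ : ContDiff ℝ 1 fun p : ℝ × ℝ² => θ p.1 p.2) (ht : t ∈ Icc a b) (x : ℝ²) :
    ‖fderiv ℝ (θ t) x‖ ≤ maxGradient θ R t := by
  by_cases hx : ‖x‖ ≤ R
  · refine le_csSup ?_ ⟨x, mem_closedBall_zero_iff.2 hx, rfl⟩
    exact ((isCompact_closedBall (0 : ℝ²) R).image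
      ((contDiff_slice hθ t).continuous_fderiv (by norm_num)).norm).bddAbove
  · rw [hR.fderiv_eq_zero ht (not_le.1 hx), norm_zero]
    exact maxGradient_nonneg

end MaxGradient

lemma IsTransported.norm_fderiv_le {θ : ℝ → ℝ² → ℝ} {v : ℝ → ℝ² → ℝ²} {a b V K : ℝ}
    (hθ : ContDiff ℝ 1 fun p : ℝ × ℝ² => θ p.1 p.2) (h : IsTransported θ v a b)
    (hv : IsLipschitzVelocity v a b V K) {L : ℝ → ℝ} (hL : Continuous L)
    (hvL : ∀ t ∈ Icc a b, ∀ x y, ‖v t x - v t y‖ ≤ L t * ‖x - y‖) {G : ℝ}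
    (hG : ∀ x, ‖fderiv ℝ (θ a) x‖ ≤ G) {t : ℝ} (ht : t ∈ Icc a b) (x : ℝ²) :
    ‖fderiv ℝ (θ t) x‖ ≤ G * Real.exp (∫ s in a..t, L s) := by
  have hG0 : 0 ≤ G := (norm_nonneg _).trans (hG 0)
  have hsub : Icc a t ⊆ Icc a b := Icc_subset_Icc_right ht.2
  have hv' : IsLipschitzVelocity v a t V K :=
    ⟨fun x => (hv.continuousOn x).mono hsub, fun s hs => hv.norm_le s (hsub hs),
      fun s hs => hv.norm_sub_le s (hsub hs)⟩
  have h' : IsTransported θ v a t := fun s hs => h s (hsub hs)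
  refine norm_fderiv_le_of_lip' ℝ (by positivity) (.of_forall fun y => ?_)
  exact h'.abs_sub_le hθ hv' hL (fun s hs => hvL s (hsub hs)) ht.1 hG0
    (abs_sub_le_of_fderiv_le ((contDiff_slice hθ a).differentiable (by norm_num)) hG) y x

lemma IsSolutionOn.two_add_mul_norm_fderiv_le {σp σm : ℝ → ℝ² → ℝ} {T : ℝ}
    (h : IsSolutionOn σp σm 0 T) {M A G l : ℝ} (hM : 0 < M) (hA : 0 < A) (hl : 0 < l)
    (hlAM : l ^ 2 = A / M ^ 3) (hMp : ∀ x, |σp 0 x| ≤ M) (hMm : ∀ x, |σm 0 x| ≤ M)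
    (hAp : ∫ x, |σp 0 x| ≤ A) (hAm : ∫ x, |σm 0 x| ≤ A)
    (hGp : ∀ x, ‖fderiv ℝ (σp 0) x‖ ≤ G) (hGm : ∀ x, ‖fderiv ℝ (σm 0) x‖ ≤ G)
    {t : ℝ} (ht : t ∈ Icc 0 T) (x : ℝ²) :
    2 + l * max ‖fderiv ℝ (σp t) x‖ ‖fderiv ℝ (σm t) x‖ ≤
      Real.exp (Real.exp (logLipConst * M * t) * Real.log (2 + l * G)) := by
  have hG0 : 0 ≤ G := (norm_nonneg _).trans (hGp 0)
  have hlip := logLipConst_pos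
  have hT : (0 : ℝ) ∈ Icc 0 T := left_mem_Icc.2 (ht.1.trans ht.2)
  obtain ⟨R, hRp, hRm⟩ := h.exists_isSupportedIn
  have hB := fun s (hs : s ∈ Icc 0 T) => h.sizeBound hRp hRm hT hs
    ⟨hMp, hAp, hRp 0 hT⟩ ⟨hMm, hAm, hRm 0 hT⟩
  obtain ⟨Kp, hKp⟩ := hRp.exists_isLipschitzVelocity h.contDiff_pos
    (fun s hs => (hB s hs).1.abs_le) (fun s hs => (hB s hs).1.integral_le)
  obtain ⟨Km, hKm⟩ := hRm.exists_isLipschitzVelocity h.contDiff_neg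
    (fun s hs => (hB s hs).2.abs_le) (fun s hs => (hB s hs).2.integral_le)
  set g : ℝ → ℝ := fun s => max (maxGradient σp R s) (maxGradient σm R s)
  have hg : Continuous g :=
    (continuous_maxGradient h.contDiff_pos R).max (continuous_maxGradient h.contDiff_neg R)
  have hg0 : ∀ s, 0 ≤ g s := fun s => le_max_of_le_left maxGradient_nonneg
  have hgp : ∀ s ∈ Icc 0 T, ∀ x, ‖fderiv ℝ (σp s) x‖ ≤ g s := fun s hs x =>
    (hRp.norm_fderiv_le_maxGradient h.contDiff_pos hs x).trans (le_max_left _ _)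
  have hgm : ∀ s ∈ Icc 0 T, ∀ x, ‖fderiv ℝ (σm s) x‖ ≤ g s := fun s hs x =>
    (hRm.norm_fderiv_le_maxGradient h.contDiff_neg hs x).trans (le_max_right _ _)
  have hpos : ∀ s, 0 < 2 + l * g s := fun s => by have := hg0 s; positivity
  set y : ℝ → ℝ := fun s => Real.log (2 + l * g s)
  have hy : Continuous y :=
    (continuous_const.add (continuous_const.mul hg)).log fun s => (hpos s).ne'
  have hy0 : ∀ s, 0 ≤ y s := fun s =>
    Real.log_nonneg (by have := mul_nonneg hl.le (hg0 s); linarith)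
  set L : ℝ → ℝ := fun s => logLipConst * M * y s
  have hL : Continuous L := continuous_const.mul hy
  have hLp : ∀ s ∈ Icc 0 T, ∀ x y,
      ‖biotSavart (σp s) x - biotSavart (σp s) y‖ ≤ L s * ‖x - y‖ := fun s hs =>
    norm_biotSavart_sub_le_log (contDiff_slice h.contDiff_pos s).continuous
      (h.hasCompactSupport_pos s) (hB s hs).1.abs_le (hB s hs).1.integral_le
      (abs_sub_le_of_fderiv_le
        ((contDiff_slice h.contDiff_pos s).differentiable (by norm_num)) (hgp s hs))
      hM hA (hg0 s) hl hlAM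
  have hLm : ∀ s ∈ Icc 0 T, ∀ x y,
      ‖-biotSavart (σm s) x - -biotSavart (σm s) y‖ ≤ L s * ‖x - y‖ := fun s hs x y => by
    rw [neg_sub_neg, norm_sub_rev]
    exact norm_biotSavart_sub_le_log (contDiff_slice h.contDiff_neg s).continuous
      (h.hasCompactSupport_neg s) (hB s hs).2.abs_le (hB s hs).2.integral_le
      (abs_sub_le_of_fderiv_le
        ((contDiff_slice h.contDiff_neg s).differentiable (by norm_num)) (hgm s hs))
      hM hA (hg0 s) hl hlAM x y
  have hgle : ∀ s ∈ Icc 0 T, g s ≤ G * Real.exp (∫ r in (0 : ℝ)..s, L r) := fun s hs =>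
    max_le
      (maxGradient_le (by positivity)
        (h.transported_pos.norm_fderiv_le h.contDiff_pos hKm.neg hL hLm hGp hs))
      (maxGradient_le (by positivity)
        (h.transported_neg.norm_fderiv_le h.contDiff_neg hKp hL hLp hGm hs))
  have hyle : ∀ s ∈ Icc 0 T,
      y s ≤ Real.log (2 + l * G) + ∫ r in (0 : ℝ)..s, logLipConst * M * y r := by
    intro s hs
    have hI : 0 ≤ ∫ r in (0 : ℝ)..s, L r :=
      intervalIntegral.integral_nonneg hs.1 fun r _ => mul_nonneg (by positivity) (hy0 r)
    have h1 := Real.one_le_exp hI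
    have h2 := mul_le_mul_of_nonneg_left (hgle s hs) hl.le
    have h3 : 2 + l * g s ≤ (2 + l * G) * Real.exp (∫ r in (0 : ℝ)..s, L r) := by nlinarith
    refine (Real.log_le_log (hpos s) h3).trans (le_of_eq ?_)
    rw [Real.log_mul (by positivity) (Real.exp_ne_zero _), Real.log_exp]
  have hfin := le_mul_exp_of_le_add_integral hy (by positivity) hyle ht
  rw [mul_comm] at hfin
  refine le_trans ?_ ((Real.log_le_iff_le_exp (hpos t)).1 hfin)
  gcongr
  exact max_le (hgp t ht x) (hgm t ht x)

/-- A priori doubly exponential gradient bound for smooth,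
compactly supported solutions of the unscreened right-handed system: there is a
universal constant `C > 0` such that with `τ± = σ±(0,·)`, for all `t ∈ [0,T]` and
both signs,
`2 + (‖τ‖_{L¹}^{1/2}/‖τ‖_{L∞}^{3/2}) ‖∇σ±(t)‖_{L∞}
  ≤ exp[ e^{Ct‖τ‖_{L∞}} log(2 + ‖∇τ‖_{L∞}‖τ‖_{L¹}^{1/2}/‖τ‖_{L∞}^{3/2}) ]`,
where `‖τ‖ = max{‖τ₊‖, ‖τ₋‖}` and similarly for `‖∇τ‖`. -/
theorem apriori_gradient_double_exponential :
    ∃ C : ℝ, 0 < C ∧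
      ∀ (T : ℝ), 0 < T →
      ∀ σp σm : ℝ → EuclideanSpace ℝ (Fin 2) → ℝ,
        (ContDiff ℝ (⊤ : ℕ∞) fun p : ℝ × EuclideanSpace ℝ (Fin 2) => σp p.1 p.2) →
        (ContDiff ℝ (⊤ : ℕ∞) fun p : ℝ × EuclideanSpace ℝ (Fin 2) => σm p.1 p.2) →
        (∀ t, HasCompactSupport (σp t)) → (∀ t, HasCompactSupport (σm t)) →
        (∀ t ∈ Icc (0:ℝ) T, ∀ x,
          deriv (fun s => σp s x) t - fderiv ℝ (σp t) x (biotSavart (σm t) x) = 0 ∧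
          deriv (fun s => σm s x) t + fderiv ℝ (σm t) x (biotSavart (σp t) x) = 0) →
        ¬(σp 0 = 0 ∧ σm 0 = 0) →
        ∀ t ∈ Icc (0:ℝ) T, ∀ σ ∈ ({σp, σm} : Set (ℝ → EuclideanSpace ℝ (Fin 2) → ℝ)),
          2 + (max (l1Norm (σp 0)) (l1Norm (σm 0)) ^ ((1:ℝ)/2) /
                max (lInfNorm (σp 0)) (lInfNorm (σm 0)) ^ ((3:ℝ)/2)) *
              gradLInfNorm (σ t) ≤
            Real.exp (Real.exp (C * t * max (lInfNorm (σp 0)) (lInfNorm (σm 0))) *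
              Real.log (2 + max (gradLInfNorm (σp 0)) (gradLInfNorm (σm 0)) *
                max (l1Norm (σp 0)) (l1Norm (σm 0)) ^ ((1:ℝ)/2) /
                  max (lInfNorm (σp 0)) (lInfNorm (σm 0)) ^ ((3:ℝ)/2))) := by
  refine ⟨logLipConst, logLipConst_pos, ?_⟩
  intro T _ σp σm hσp hσm hsp hsm heq hne t ht σ hσ
  have h : IsSolutionOn σp σm 0 T :=
    { contDiff_pos := hσp.of_le (by exact_mod_cast le_top)
      contDiff_neg := hσm.of_le (by exact_mod_cast le_top)
      hasCompactSupport_pos := hsp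
      hasCompactSupport_neg := hsm
      transported_pos := fun s hs x => by
        rw [map_neg, ← sub_eq_add_neg]; exact (heq s hs x).1
      transported_neg := fun s hs x => (heq s hs x).2 }
  have hp := contDiff_slice h.contDiff_pos 0
  have hm := contDiff_slice h.contDiff_neg 0
  set M := max (lInfNorm (σp 0)) (lInfNorm (σm 0))
  set A := max (l1Norm (σp 0)) (l1Norm (σm 0))
  set G := max (gradLInfNorm (σp 0)) (gradLInfNorm (σm 0))
  have hMA : 0 < M ∧ 0 < A := by
    rcases not_and_or.1 hne with h0 | h0
    · exact ⟨lt_max_of_lt_left (lInfNorm_pos hp.continuous (hsp 0) h0),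
        lt_max_of_lt_left (l1Norm_pos hp.continuous (hsp 0) h0)⟩
    · exact ⟨lt_max_of_lt_right (lInfNorm_pos hm.continuous (hsm 0) h0),
        lt_max_of_lt_right (l1Norm_pos hm.continuous (hsm 0) h0)⟩
  obtain ⟨hM, hA⟩ := hMA
  set l := A ^ ((1:ℝ)/2) / M ^ ((3:ℝ)/2) with hl_def
  have hl : 0 < l := by positivity
  have hlAM : l ^ 2 = A / M ^ 3 := by
    rw [hl_def, div_pow, ← Real.rpow_natCast, ← Real.rpow_natCast, ← Real.rpow_mul hA.le,
      ← Real.rpow_mul hM.le]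
    norm_num
  have key := h.two_add_mul_norm_fderiv_le (G := G) hM hA hl hlAM
    (fun x => (abs_le_lInfNorm hp.continuous (hsp 0) x).trans (le_max_left _ _))
    (fun x => (abs_le_lInfNorm hm.continuous (hsm 0) x).trans (le_max_right _ _))
    ((integral_abs_eq_l1Norm hp.continuous).le.trans (le_max_left _ _))
    ((integral_abs_eq_l1Norm hm.continuous).le.trans (le_max_right _ _))
    (fun x => (norm_fderiv_le_gradLInfNorm hp (hsp 0) x).trans (le_max_left _ _))
    (fun x => (norm_fderiv_le_gradLInfNorm hm (hsm 0) x).trans (le_max_right _ _)) ht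
  rw [mul_div_assoc, ← hl_def, mul_comm G l, mul_right_comm, ← le_sub_iff_add_le', mul_comm l,
    ← le_div_iff₀ hl]
  refine gradLInfNorm_le fun x => ?_
  rw [le_div_iff₀ hl, mul_comm, le_sub_iff_add_le']
  refine le_trans ?_ (key x)
  rcases hσ with rfl | rfl
  · gcongr; exact le_max_left _ _
  · gcongr; exact le_max_right _ _
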